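/- arXiv:2407.10190 — 11 statements merged into one kernel-verified Lean document; each statement's English description precedes it below -/
import Mathlib

section
/- If a set X of ordinals is ultimately periodic in an ordinal Ω, then there exist an ordinal β and a natural number n with 0 < n such that X is ultimately periodic in Ω with some offset length and with period length ω^β·n. -/
open Ordinal Set Filter

/-- `X` is ultimately periodic in `Ω` with offset length `δ`, period length `π`
and exponent `lam`. -/
def UPWith (X : Set Ordinal) (Ω δ π lam : Ordinal) : Prop :=
  δ < Ω ∧ 0 < π ∧ Order.IsSuccLimit lam ∧ Ω = δ + π * lam ∧
    ∀ γ < lam, ∀ ξ < π, (δ + π * γ + ξ ∈ X ↔ δ + ξ ∈ X)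

/-- `X` is ultimately periodic in `Ω` with offset length `δ` and period length `π`. -/
def UPIn (X : Set Ordinal) (Ω δ π : Ordinal) : Prop := ∃ lam, UPWith X Ω δ π lam

/-- `X` is ultimately periodic in `Ω`. -/
def UP (X : Set Ordinal) (Ω : Ordinal) : Prop := ∃ δ π, UPIn X Ω δ π

/-- `X` is periodic in `Ω` with period length `π`. -/
def PeriodicIn (X : Set Ordinal) (Ω π : Ordinal) : Prop := UPIn X Ω 0 π

/-- `H₀(Ω)`: the family of subsets of `Ω` that are hereditarily periodic in `Ω`. -/
def H0 (Ω : Ordinal) : Set (Set Ordinal) :=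
  {X | X ⊆ Set.Iio Ω ∧ ∀ β ≤ Ω, Order.IsSuccLimit β → UP (X ∩ Set.Iio β) β}

/-- `ℓ(α)`: the last (smallest) exponent in the Cantor normal form of `α`, with `ℓ(0) = 0`. -/
noncomputable def ell (α : Ordinal) : Ordinal :=
  (((Ordinal.CNF Ordinal.omega0 α).getLast?).map Prod.fst).getD 0

/-- The derived-set operator of a topology `t`. -/
def dSet {X : Type*} (t : TopologicalSpace X) (S : Set X) : Set X :=
  {x | @AccPt X t x (Filter.principal S)}

/-- `d₀`: the derived-set operator of the order (interval) topology on the ordinals. -/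
noncomputable def d0 : Set Ordinal → Set Ordinal := dSet inferInstance

/-- Icard's topology `ϑ_n` on the ordinals. -/
noncomputable def icard (n : ℕ) : TopologicalSpace Ordinal :=
  TopologicalSpace.generateFrom
    ({U | IsOpen U} ∪
      {U | ∃ m : ℕ, 1 ≤ m ∧ m ≤ n ∧ ∃ β : Ordinal, U = {α | β < ell^[m] α}})

/-- `d_n`: the derived-set operator of Icard's topology `ϑ_n`. -/
noncomputable def dIcard (n : ℕ) : Set Ordinal → Set Ordinal := dSet (icard n)

/-- The base family `V_n(Ω)` of `n`-periodic subsets of `Ω`. -/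
def Vn : ℕ → Ordinal → Set (Set Ordinal)
  | 0, Ω => H0 Ω
  | (n+1), Ω => {S | ∃ B ∈ H0 Ω, ∃ A ∈ Vn n Ω, S = B ∩ {α | α < Ω ∧ ell α ∈ A}}

/-- `H_n(Ω)`: finite unions of members of `V_n(Ω)`, the `n`-periodic subsets of `Ω`. -/
def Hn (n : ℕ) (Ω : Ordinal) : Set (Set Ordinal) :=
  {S | ∃ F : Finset (Set Ordinal), ↑F ⊆ Vn n Ω ∧ S = ⋃₀ ↑F}

theorem aux_limit (lam : Ordinal) (h : Order.IsSuccLimit lam) :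
    ∃ mu, lam = ω * mu ∧ mu ≠ 0 := by
  obtain ⟨mu, rfl⟩ := (Ordinal.isSuccPrelimit_iff_omega0_dvd.1 h.isSuccPrelimit)
  refine ⟨mu, rfl, ?_⟩
  rintro rfl
  simpa using h.bot_lt

theorem aux_decomp (p : Ordinal) (hp : 0 < p) :
    ∃ (b : Ordinal) (n : ℕ) (r : Ordinal), 0 < n ∧ p = ω ^ b * (n : Ordinal) + r ∧ r < ω ^ b := by
  have h0 : (ω ^ (Ordinal.log ω p) : Ordinal) ≠ 0 := (Ordinal.opow_pos _ omega0_pos).ne'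
  have hlt : p / ω ^ (Ordinal.log ω p) < ω := Ordinal.div_opow_log_lt p one_lt_omega0
  obtain ⟨n, hn⟩ := Ordinal.lt_omega0.1 hlt
  refine ⟨Ordinal.log ω p, n, p % ω ^ (Ordinal.log ω p), ?_, ?_, Ordinal.mod_lt _ h0⟩
  · have := Ordinal.div_opow_log_pos ω hp.ne'
    rw [hn] at this
    exact_mod_cast this
  · rw [← hn, Ordinal.div_add_mod]

theorem aux_mul_omega (b r : Ordinal) (n : ℕ) (hn : 0 < n) (hr : r < ω ^ b) :
    (ω ^ b * (n : Ordinal) + r) * ω = ω ^ (b + 1) := by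
  rw [← Order.succ_eq_add_one, Ordinal.opow_succ]
  apply le_antisymm
  · calc (ω ^ b * (n : Ordinal) + r) * ω ≤ (ω ^ b * ((n + 1 : ℕ) : Ordinal)) * ω := by
          gcongr
          push_cast
          rw [mul_add, mul_one]
          gcongr
      _ = ω ^ b * ω := by
          rw [mul_assoc, Ordinal.natCast_mul_omega0 (Nat.succ_pos n)]
  · gcongr
    refine le_trans ?_ le_self_add
    have : (1 : Ordinal) ≤ n := by exact_mod_cast hn
    calc ω ^ b = ω ^ b * 1 := by simp
      _ ≤ _ := by gcongr

theorem aux_absorb (b r : Ordinal) (n : ℕ) (hn : 0 < n) (hr : r < ω ^ b) :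
    r + ω ^ b * (n : Ordinal) = ω ^ b * (n : Ordinal) := by
  obtain ⟨m, rfl⟩ : ∃ m, n = 1 + m := ⟨n - 1, by omega⟩
  push_cast
  rw [mul_add, mul_one, ← add_assoc, Ordinal.add_omega0_opow hr]

theorem aux_shift (P r : Ordinal) (h : r + P = P) (k : ℕ) :
    P + P * (k : Ordinal) = (P + r) * (k : Ordinal) + P := by
  induction k with
  | zero => simp
  | succ k ih =>
    push_cast
    rw [mul_add, mul_one, ← add_assoc, ih, mul_add, mul_one]
    simp only [add_assoc]
    rw [h]

/-- If `X` is ultimately periodic in `Ω`, then it is ultimately periodic in `Ω`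
with some offset length and with period length of the form `ω^β·n`, `0 < n < ω`. -/
theorem up_period_omega_pow_mul_nat (Ω : Ordinal) (X : Set Ordinal) (h : UP X Ω) :
    ∃ (β : Ordinal) (n : ℕ), 0 < n ∧ ∃ δ : Ordinal,
      UPIn X Ω δ (Ordinal.omega0 ^ β * (n : Ordinal)) := by
  obtain ⟨δ, p, lam, hδ, hp, hlam, hΩ, hX⟩ := h
  obtain ⟨mu, rfl, hmu⟩ := aux_limit lam hlam
  obtain ⟨b, n, r, hn, rfl, hr⟩ := aux_decomp p hp
  have hpw := aux_mul_omega b r n hn hr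
  have hPw := aux_mul_omega b 0 n hn (Ordinal.opow_pos _ omega0_pos)
  rw [add_zero] at hPw
  have habs := aux_absorb b r n hn hr
  have hP : 0 < ω ^ b * (n : Ordinal) :=
    mul_pos (Ordinal.opow_pos _ omega0_pos) (by exact_mod_cast hn)
  rcases Ordinal.zero_or_succ_or_isSuccLimit mu with h0 | ⟨nu, hnu⟩ | hl
  · exact absurd h0 hmu
  · refine ⟨b, n, hn, ?_⟩
    generalize ω ^ b * (n : Ordinal) = P at *
    refine ⟨δ + (P + r) * (ω * nu) + P, ω, ?_⟩
    have hmu' : mu = nu + 1 := by rw [← hnu, Order.succ_eq_add_one]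
    subst hmu'
    have hPP : P + P * ω = P * ω := by
      conv_lhs => rw [← mul_one P, mul_assoc, one_mul, ← mul_add, Ordinal.one_add_omega0]
    have hΩ' : Ω = δ + (P + r) * (ω * nu) + P + P * ω := by
      rw [add_assoc _ P, hPP, hΩ, mul_add ω, mul_one, mul_add (P + r), ← add_assoc, hpw, hPw]
    refine ⟨?_, hP, Ordinal.isSuccLimit_omega0, hΩ', ?_⟩
    · conv_rhs => rw [hΩ']
      exact lt_add_of_pos_right _ (mul_pos hP omega0_pos)
    · have key : ∀ k : ℕ, ∀ ξ < P, (δ + (P + r) * (ω * nu) + P + P * (k : Ordinal) + ξ ∈ X ↔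
          ((ξ < r ∧ δ + (P + ξ) ∈ X) ∨ (r ≤ ξ ∧ δ + (ξ - r) ∈ X))) := by
        intro k ξ hξ
        have hlt : ∀ j : ℕ, ω * nu + (j : Ordinal) < ω * (nu + 1) := by
          intro j
          rw [mul_add, mul_one]
          gcongr
          exact natCast_lt_omega0 j
        rw [add_assoc _ P, aux_shift P r habs k]
        rcases lt_or_ge ξ r with hx | hx
        · have := hX _ (hlt k) (P + ξ) (by gcongr)
          rw [mul_add (P + r)] at this
          simp only [add_assoc] at this ⊢
          simp [this, hx, hx.not_ge]
        · have := hX _ (hlt (k + 1)) (ξ - r)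
            (((Ordinal.sub_le_self _ _).trans_lt hξ).trans_le le_self_add)
          push_cast at this
          rw [mul_add (P + r), mul_add (P + r), mul_one] at this
          simp only [add_assoc, Ordinal.add_sub_cancel_of_le hx] at this ⊢
          simp [this, hx, hx.not_gt]
      intro γ hγ ξ hξ
      obtain ⟨k, rfl⟩ := Ordinal.lt_omega0.1 hγ
      have h0 := key 0 ξ hξ
      simp only [Nat.cast_zero, mul_zero, add_zero] at h0
      rw [key k ξ hξ, h0]
  · refine ⟨b + 1, 1, one_pos, δ, mu, hδ, ?_, hl, ?_, ?_⟩
    · rw [Nat.cast_one, mul_one]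
      exact Ordinal.opow_pos _ omega0_pos
    · rw [hΩ, Nat.cast_one, mul_one, ← hpw, mul_assoc]
    · intro γ hγ ξ hξ
      rw [Nat.cast_one, mul_one, ← hpw] at *
      generalize hq : ω ^ b * (n : Ordinal) + r = q at *
      have hξ1 : ξ / q < ω := (Ordinal.lt_mul_iff_div_lt hp.ne').1 hξ
      have hξ2 : ξ % q < q := Ordinal.mod_lt _ hp.ne'
      have hlt : ω * γ + ξ / q < ω * mu := by
        calc ω * γ + ξ / q < ω * γ + ω := by gcongr
          _ = ω * (γ + 1) := by rw [mul_add, mul_one]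
          _ ≤ ω * mu := by gcongr; exact Order.add_one_le_of_lt hγ
      have hlt0 : ξ / q < ω * mu :=  le_add_self.trans_lt hlt
      have h1 := hX _ hlt _ hξ2
      have h2 := hX _ hlt0 _ hξ2
      rw [mul_add, add_assoc, add_assoc, Ordinal.div_add_mod, ← mul_assoc, ← add_assoc] at h1
      rw [add_assoc, Ordinal.div_add_mod] at h2
      rw [h1, h2]
end

section
/- (Synchronization lemma) Suppose X and Y are sets of ordinals that are both ultimately periodic in the same ordinal Ω. Then X and Y synchronize: there exist an ordinal δ with δ < Ω, an ordinal π with 0 < π, and a limit ordinal λ with Ω = δ + π·λ, such that for all γ < λ and all ξ < π, both (δ + π·γ + ξ ∈ X iff δ + ξ ∈ X) and (δ + π·γ + ξ ∈ Y iff δ + ξ ∈ Y); i.e., X and Y are ultimately periodic in Ω with a common offset length δ, common period length π, and common exponent λ. -/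
open Ordinal Set Filter

namespace SyncAux

universe u

/-- Every limit ordinal has the form `σ + ω ^ a` with `a ≠ 0`. -/
theorem exists_tail {lam : Ordinal.{u}} (h : Order.IsSuccLimit lam) :
    ∃ σ a : Ordinal.{u}, a ≠ 0 ∧ lam = σ + ω ^ a := by
  have hne : ({τ : Ordinal.{u} | 0 < τ ∧ ∃ σ, σ + τ = lam}).Nonempty :=
    ⟨lam, (Ordinal.isSuccLimit_iff.1 h).1.pos, 0, by simp⟩
  obtain ⟨τ, ⟨hτ0, σ, hσ⟩, hmin⟩ := WellFounded.has_min
    (wellFounded_lt : WellFounded ((· < ·) : Ordinal.{u} → Ordinal.{u} → Prop)) _ hne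
  have hp : IsPrincipal (· + ·) τ := by
    by_contra hc
    obtain ⟨b, hb, c, hc, hbc⟩ := exists_lt_add_of_not_isPrincipal_add hc
    refine hmin c ⟨?_, σ + b, ?_⟩ hc
    · rcases eq_or_ne c 0 with rfl | h0
      · simp at hbc; exact absurd hbc hb.ne
      · exact h0.pos
    · rw [add_assoc, hbc, hσ]
  rcases isPrincipal_add_iff_zero_or_omega0_opow.1 hp with h0 | ⟨a, ha⟩
  · exact absurd h0 hτ0.ne'
  · refine ⟨σ, a, ?_, ?_⟩
    · rintro rfl
      simp only [opow_zero] at ha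
      subst ha
      have h2 := h.2
      rw [← hσ, ← Order.succ_eq_add_one] at h2
      exact Order.not_isSuccPrelimit_succ σ h2
    · rw [← hσ, ← ha]

/-- Leading term decomposition. -/
theorem leading {π : Ordinal.{u}} (h : 0 < π) :
    ∃ (e : Ordinal.{u}) (n : ℕ) (r : Ordinal.{u}), 0 < n ∧ r < ω ^ e ∧ π = ω ^ e * n + r := by
  obtain ⟨n, hn⟩ := lt_omega0.1 (div_opow_log_lt (b := ω) π one_lt_omega0)
  refine ⟨log ω π, n, π % ω ^ log ω π, ?_, ?_, ?_⟩
  · have := div_opow_log_pos ω h.ne'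
    rw [hn] at this
    exact_mod_cast this
  · exact Ordinal.mod_lt _ (opow_pos _ omega0_pos).ne'
  · rw [← hn, Ordinal.div_add_mod]

theorem nat_mul_opow {n : ℕ} (hn : 0 < n) {q : Ordinal.{u}} (hq : q ≠ 0) :
    (n : Ordinal.{u}) * ω ^ q = ω ^ q :=
  mul_omega0_dvd (by exact_mod_cast hn) (natCast_lt_omega0 n)
    (by simpa using opow_dvd_opow ω (Order.one_le_iff_pos.2 hq.pos))

theorem absorb {e r : Ordinal.{u}} {n : ℕ} (hn : 0 < n) (hr : r < ω ^ e) :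
    r + ω ^ e * n = ω ^ e * n :=
  add_of_omega0_opow_le hr (by
    have : (1 : Ordinal.{u}) ≤ n := by exact_mod_cast hn
    simpa using mul_le_mul_right this (ω ^ e))

theorem mul_opow {e r : Ordinal.{u}} {n : ℕ} (hn : 0 < n) (hr : r < ω ^ e)
    {q : Ordinal.{u}} (hq : q ≠ 0) : (ω ^ e * n + r) * ω ^ q = ω ^ (e + q) := by
  rw [add_mul_of_isSuccLimit (absorb hn hr) (isSuccLimit_opow_left isSuccLimit_omega0 hq),
    mul_assoc, nat_mul_opow hn hq, opow_add]

/-- The normalized form of ultimate periodicity. -/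
theorem normalize {X : Set Ordinal.{u}} {Ω : Ordinal.{u}} (h : UP X Ω) :
    ∃ (δ ρ e : Ordinal.{u}) (n : ℕ) (r : Ordinal.{u}), 0 < n ∧ r < ω ^ e ∧ e < ρ ∧
      Ω = δ + ω ^ ρ ∧
      ∀ μ, (ω ^ e * n + r) * μ < ω ^ ρ → ∀ x < ω ^ ρ,
        (δ + ((ω ^ e * n + r) * μ + x) ∈ X ↔ δ + x ∈ X) := by
  obtain ⟨δ, π, lam, hδ, hπ, hl, hΩ, hper⟩ := h
  obtain ⟨σ, a, ha, rfl⟩ := exists_tail hl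
  obtain ⟨e, n, r, hn, hr, hπe⟩ := leading hπ
  have hκ : π * ω ^ a = ω ^ (e + a) := by rw [hπe, mul_opow hn hr ha]
  refine ⟨δ + π * σ, e + a, e, n, r, hn, hr, ?_, ?_, ?_⟩
  · simpa using (add_lt_add_iff_left e).2 ha.pos
  · rw [hΩ, mul_add, hκ, add_assoc]
  · rw [← hπe, ← hκ]
    intro μ hμ x hx
    have hμ' : μ < ω ^ a := by
      by_contra hc
      exact absurd hμ (not_lt.2 (mul_le_mul_right (not_lt.1 hc) π))
    have hx' : x / π < ω ^ a := (lt_mul_iff_div_lt hπ.ne').1 hx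
    have key : ∀ ν < ω ^ a, ∀ ξ < π, (δ + π * σ + (π * ν + ξ) ∈ X ↔ δ + ξ ∈ X) := by
      intro ν hν ξ hξ
      have := hper (σ + ν) ((add_lt_add_iff_left σ).2 hν) ξ hξ
      rwa [mul_add, ← add_assoc, add_assoc _ _ ξ] at this
    have hm : x % π < π := Ordinal.mod_lt _ hπ.ne'
    have h1 := key (μ + x / π) (isPrincipal_add_omega0_opow a hμ' hx') _ hm
    have h2 := key (x / π) hx' _ hm
    rw [Ordinal.div_add_mod] at h2
    rw [mul_add, add_assoc (π * μ), Ordinal.div_add_mod] at h1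
    rw [h1, h2]

theorem tail_le {δ₁ δ₂ ρ₁ ρ₂ : Ordinal.{u}} (hle : δ₁ ≤ δ₂)
    (h : δ₁ + ω ^ ρ₁ = δ₂ + ω ^ ρ₂) : ρ₁ = ρ₂ := by
  obtain ⟨η, rfl⟩ := le_iff_exists_add.1 hle
  rw [add_assoc] at h
  have h := add_left_cancel h
  have h2 : ω ^ ρ₂ ≤ ω ^ ρ₁ := h ▸ le_add_self
  have h3 : η < ω ^ ρ₁ := by
    rw [h]
    simpa using (add_lt_add_iff_left η).2 (opow_pos ρ₂ omega0_pos)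
  rcases h2.lt_or_eq with h4 | h4
  · exact absurd (isPrincipal_add_omega0_opow ρ₁ h3 h4) (by simp [← h])
  · exact ((opow_right_inj one_lt_omega0).1 h4).symm

theorem tail_unique {δ₁ δ₂ ρ₁ ρ₂ : Ordinal.{u}}
    (h : δ₁ + ω ^ ρ₁ = δ₂ + ω ^ ρ₂) : ρ₁ = ρ₂ := by
  rcases le_total δ₁ δ₂ with hle | hle
  · exact tail_le hle h
  · exact (tail_le hle h.symm).symm

/-- Moving the offset up to `δ' + ω ^ c`. -/
theorem move {δ δ' ρ c : Ordinal.{u}} (hc : c < ρ) (hle : δ ≤ δ') (hlt : δ' < δ + ω ^ ρ) :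
    ∃ μ, δ' + ω ^ c = δ + ω ^ c * μ ∧ ω ^ c * μ < ω ^ ρ ∧
      δ + ω ^ ρ = δ' + ω ^ c + ω ^ ρ := by
  obtain ⟨η, rfl⟩ := le_iff_exists_add.1 hle
  have hη : η < ω ^ ρ := (add_lt_add_iff_left δ).1 hlt
  have hpos : (ω : Ordinal.{u}) ^ c ≠ 0 := (opow_pos c omega0_pos).ne'
  have hcρ : (ω : Ordinal.{u}) ^ c < ω ^ ρ := (opow_lt_opow_iff_right one_lt_omega0).2 hc
  have e1 : η + ω ^ c = ω ^ c * (η / ω ^ c + 1) := by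
    conv_lhs => rw [← Ordinal.div_add_mod η (ω ^ c)]
    rw [add_assoc, add_omega0_opow (Ordinal.mod_lt _ hpos), mul_add, mul_one]
  refine ⟨η / ω ^ c + 1, by rw [add_assoc, e1], ?_, ?_⟩
  · rw [← e1]
    exact isPrincipal_add_omega0_opow ρ hη hcρ
  · rw [add_assoc, add_assoc, add_omega0_opow hcρ, add_omega0_opow hη]

/-- The normal form when the exponent of the last term is a successor. -/
theorem kindA {X : Set Ordinal.{u}} {Ω δ c e r : Ordinal.{u}} {n : ℕ}
    (hn : 0 < n) (hr : r < ω ^ e) (he : e < c + 1) (hΩ : Ω = δ + ω ^ (c + 1))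
    (h : ∀ μ, (ω ^ e * n + r) * μ < ω ^ (c + 1) → ∀ x < ω ^ (c + 1),
        (δ + ((ω ^ e * n + r) * μ + x) ∈ X ↔ δ + x ∈ X)) :
    ∃ (δ' : Ordinal.{u}) (m : ℕ), 0 < m ∧ Ω = δ' + ω ^ (c + 1) ∧
      ∀ x < ω ^ (c + 1), (δ' + (ω ^ c * m + x) ∈ X ↔ δ' + x ∈ X) := by
  have hc1 : c < c + 1 := lt_add_one c
  rcases (Order.lt_add_one_iff.1 he).lt_or_eq with hlt | rfl
  · obtain ⟨q, rfl⟩ := le_iff_exists_add.1 hlt.le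
    have hq : q ≠ 0 := by rintro rfl; simp at hlt
    refine ⟨δ, 1, one_pos, hΩ, fun x hx => ?_⟩
    have := h (ω ^ q)
    rw [mul_opow hn hr hq] at this
    simpa using this ((opow_lt_opow_iff_right one_lt_omega0).2 hc1) x hx
  · have hlt := omega0_opow_mul_nat_lt hc1 n
    refine ⟨δ + ω ^ e * n, n, hn, ?_, fun x hx => ?_⟩
    · rw [hΩ, add_assoc, add_omega0_opow hlt]
    · have hp := isPrincipal_add_omega0_opow (e + 1)
      have h1 := h 1 (by
        rw [mul_one]
        exact hp hlt (hr.trans ((opow_lt_opow_iff_right one_lt_omega0).2 hc1)))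
        (ω ^ e * n + x) (hp hlt hx)
      have e1 : (ω ^ e * n + r) * 1 + (ω ^ e * n + x) = ω ^ e * n + (ω ^ e * n + x) := by
        rw [mul_one, add_assoc, ← add_assoc r, absorb hn hr]
      rw [e1] at h1
      rw [add_assoc, add_assoc]
      exact h1

theorem kindA_move {X : Set Ordinal.{u}} {δ δ' c : Ordinal.{u}} {m : ℕ}
    (h : ∀ x < ω ^ (c + 1), (δ + (ω ^ c * m + x) ∈ X ↔ δ + x ∈ X))
    (hle : δ ≤ δ') (hlt : δ' < δ + ω ^ (c + 1)) (k : ℕ) :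
    ∀ x < ω ^ (c + 1), (δ' + ω ^ c + ω ^ c * (m * k : ℕ) + x ∈ X ↔ δ' + ω ^ c + x ∈ X) := by
  have hc1 : c < c + 1 := lt_add_one c
  have hp := isPrincipal_add_omega0_opow (c + 1)
  have hk : ∀ k : ℕ, ∀ x < ω ^ (c + 1),
      (δ + (ω ^ c * (m * k : ℕ) + x) ∈ X ↔ δ + x ∈ X) := by
    intro k
    induction k with
    | zero => simp
    | succ k ih =>
      intro x hx
      have e1 : ω ^ c * (m * (k + 1) : ℕ) + x = ω ^ c * (m * k : ℕ) + (ω ^ c * m + x) := by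
        rw [← add_assoc, ← mul_add, ← Nat.cast_add, Nat.mul_succ]
      rw [e1, ih _ (hp (omega0_opow_mul_nat_lt hc1 m) hx), h x hx]
  obtain ⟨μ, h1, h2, -⟩ := move hc1 hle hlt
  have hμ : μ < ω := by
    by_contra hcon
    refine absurd h2 (not_lt.2 ?_)
    rw [opow_add, opow_one]
    exact mul_le_mul_right (not_lt.1 hcon) _
  obtain ⟨j, rfl⟩ := lt_omega0.1 hμ
  intro x hx
  have e1 : δ' + ω ^ c + ω ^ c * (m * k : ℕ) + x
      = δ + (ω ^ c * (m * k : ℕ) + (ω ^ c * j + x)) := by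
    rw [h1, add_assoc δ, ← mul_add, ← Nat.cast_add, add_comm j, Nat.cast_add, mul_add,
      add_assoc, add_assoc]
  rw [e1, hk k _ (hp h2 hx), h1, add_assoc]

/-- The normal form when the exponent of the last term is a limit. -/
theorem kindB {X : Set Ordinal.{u}} {δ δ' ρ c e r : Ordinal.{u}} {n : ℕ}
    (hn : 0 < n) (hr : r < ω ^ e) (he : e < c) (hc : c < ρ)
    (h : ∀ μ, (ω ^ e * n + r) * μ < ω ^ ρ → ∀ x < ω ^ ρ,
        (δ + ((ω ^ e * n + r) * μ + x) ∈ X ↔ δ + x ∈ X))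
    (hle : δ ≤ δ') (hlt : δ' < δ + ω ^ ρ) :
    ∀ γ, ω ^ c * γ < ω ^ ρ → ∀ x < ω ^ ρ,
      (δ' + ω ^ c + ω ^ c * γ + x ∈ X ↔ δ' + ω ^ c + x ∈ X) := by
  have hp := isPrincipal_add_omega0_opow ρ
  obtain ⟨q, hq0⟩ := le_iff_exists_add.1 he.le
  have hq : q ≠ 0 := by rintro rfl; simp at hq0; exact he.ne hq0.symm
  have hper : ∀ γ, ω ^ c * γ < ω ^ ρ → ∀ x < ω ^ ρ,
      (δ + (ω ^ c * γ + x) ∈ X ↔ δ + x ∈ X) := by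
    intro γ hγ x hx
    have := h (ω ^ q * γ)
    rw [← mul_assoc, mul_opow hn hr hq, ← hq0] at this
    exact this hγ x hx
  obtain ⟨μ, h1, h2, -⟩ := move hc hle hlt
  intro γ hγ x hx
  have e1 : δ' + ω ^ c + ω ^ c * γ + x = δ + (ω ^ c * (μ + γ) + x) := by
    rw [h1, add_assoc δ, ← mul_add, add_assoc]
  rw [e1, hper _ (by rw [mul_add]; exact hp h2 hγ) x hx, h1, add_assoc, hper _ h2 x hx]

end SyncAux

open SyncAux

/-- Synchronization lemma: two sets ultimately periodic in the same ordinal `Ω`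
admit a common offset length, period length and exponent. -/
theorem synchronization (Ω : Ordinal) (X Y : Set Ordinal)
    (hX : UP X Ω) (hY : UP Y Ω) :
    ∃ (δ π lam : Ordinal), δ < Ω ∧ 0 < π ∧ Order.IsSuccLimit lam ∧ Ω = δ + π * lam ∧
      ∀ γ < lam, ∀ ξ < π,
        ((δ + π * γ + ξ ∈ X ↔ δ + ξ ∈ X) ∧ (δ + π * γ + ξ ∈ Y ↔ δ + ξ ∈ Y)) := by
  obtain ⟨δ₁, ρ, e₁, n₁, r₁, hn₁, hr₁, he₁, hΩ₁, hX⟩ := normalize hX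
  obtain ⟨δ₂, ρ₂, e₂, n₂, r₂, hn₂, hr₂, he₂, hΩ₂, hY⟩ := normalize hY
  obtain rfl : ρ = ρ₂ := tail_unique (hΩ₁.symm.trans hΩ₂)
  rcases zero_or_succ_or_isSuccLimit ρ with rfl | ⟨c, hcρ⟩ | hρ
  · simp at he₁
  · rw [Order.succ_eq_add_one] at hcρ
    subst hcρ
    obtain ⟨δ₁, m₁, hm₁, hΩ₁, hX⟩ := kindA hn₁ hr₁ he₁ hΩ₁ hX
    obtain ⟨δ₂, m₂, hm₂, hΩ₂, hY⟩ := kindA hn₂ hr₂ he₂ hΩ₂ hY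
    have hpos : (0 : Ordinal) < ω ^ (c + 1) := opow_pos _ omega0_pos
    have hl₁ : δ₁ < Ω := by rw [hΩ₁]; simpa using (add_lt_add_iff_left δ₁).2 hpos
    have hl₂ : δ₂ < Ω := by rw [hΩ₂]; simpa using (add_lt_add_iff_left δ₂).2 hpos
    have hl : max δ₁ δ₂ < Ω := max_lt hl₁ hl₂
    have hX := kindA_move hX (le_max_left δ₁ δ₂) (hΩ₁ ▸ hl)
    have hY := kindA_move hY (le_max_right δ₁ δ₂) (hΩ₂ ▸ hl)
    obtain ⟨-, -, -, hΩ⟩ := move (lt_add_one c) (le_max_left δ₁ δ₂) (hΩ₁ ▸ hl)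
    rw [← hΩ₁] at hΩ
    have hN : 0 < m₁ * m₂ := Nat.mul_pos hm₁ hm₂
    have hlt := omega0_opow_mul_nat_lt (lt_add_one c) (m₁ * m₂)
    refine ⟨max δ₁ δ₂ + ω ^ c, ω ^ c * (m₁ * m₂ : ℕ), ω, ?_, ?_, isSuccLimit_omega0, ?_, ?_⟩
    · conv_rhs => rw [hΩ]
      simpa using (add_lt_add_iff_left (max δ₁ δ₂ + ω ^ c)).2 hpos
    · exact mul_pos (opow_pos _ omega0_pos) (by exact_mod_cast hN)
    · rw [mul_assoc, natCast_mul_omega0 hN]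
      conv_lhs => rw [hΩ, opow_add, opow_one]
    · intro γ hγ ξ hξ
      obtain ⟨k, rfl⟩ := lt_omega0.1 hγ
      have a1 := hX (m₂ * k) ξ (hξ.trans hlt)
      have a2 := hY (m₁ * k) ξ (hξ.trans hlt)
      rw [← Nat.mul_assoc, Ordinal.natCast_mul (m₁ * m₂), ← mul_assoc] at a1
      rw [← Nat.mul_assoc, Nat.mul_comm m₂, Ordinal.natCast_mul (m₁ * m₂), ← mul_assoc] at a2
      exact ⟨a1, a2⟩
  · have hpos : (0 : Ordinal) < ω ^ ρ := opow_pos _ omega0_pos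
    have hl₁ : δ₁ < Ω := by rw [hΩ₁]; simpa using (add_lt_add_iff_left δ₁).2 hpos
    have hl₂ : δ₂ < Ω := by rw [hΩ₂]; simpa using (add_lt_add_iff_left δ₂).2 hpos
    have hl : max δ₁ δ₂ < Ω := max_lt hl₁ hl₂
    obtain ⟨c, hc₁, hc₂, hc⟩ : ∃ c, e₁ < c ∧ e₂ < c ∧ c < ρ :=
      ⟨Order.succ (max e₁ e₂), Order.lt_succ_of_le (le_max_left _ _),
        Order.lt_succ_of_le (le_max_right _ _), hρ.succ_lt (max_lt he₁ he₂)⟩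
    have hX := kindB hn₁ hr₁ hc₁ hc hX (le_max_left δ₁ δ₂) (hΩ₁ ▸ hl)
    have hY := kindB hn₂ hr₂ hc₂ hc hY (le_max_right δ₁ δ₂) (hΩ₂ ▸ hl)
    obtain ⟨-, -, -, hΩ⟩ := move hc (le_max_left δ₁ δ₂) (hΩ₁ ▸ hl)
    rw [← hΩ₁] at hΩ
    obtain ⟨q, hq0⟩ := le_iff_exists_add.1 hc.le
    have hq : q ≠ 0 := by rintro rfl; simp at hq0; exact hc.ne hq0.symm
    have hcρ : (ω : Ordinal) ^ c < ω ^ ρ := (opow_lt_opow_iff_right one_lt_omega0).2 hc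
    have hκ : (ω : Ordinal) ^ ρ = ω ^ c * ω ^ q := by rw [hq0, opow_add]
    have hcpos : (0 : Ordinal) < ω ^ c := opow_pos _ omega0_pos
    refine ⟨max δ₁ δ₂ + ω ^ c, ω ^ c, ω ^ q, ?_, hcpos,
      isSuccLimit_opow_left isSuccLimit_omega0 hq, ?_, ?_⟩
    · conv_rhs => rw [hΩ]
      simpa using (add_lt_add_iff_left (max δ₁ δ₂ + ω ^ c)).2 hpos
    · rw [← hκ]
      exact hΩ
    · intro γ hγ ξ hξ
      have hγ' : ω ^ c * γ < ω ^ ρ := by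
        rw [hκ]
        exact mul_lt_mul_of_pos_left hγ hcpos
      exact ⟨hX γ hγ' ξ (hξ.trans hcρ), hY γ hγ' ξ (hξ.trans hcρ)⟩
end

section
/- For any ordinal Ω, the collection {X ⊆ Ω : X is u.p. in Ω} of ultimately periodic subsets of Ω is closed under the boolean operations: if X, Y ⊆ Ω are u.p. in Ω, then X ∪ Y, X ∩ Y, and Ω ∖ X are u.p. in Ω. -/
open Ordinal Set Filter

theorem upw_shift {X : Set Ordinal} {Ω δ π lam : Ordinal} (h : UPWith X Ω δ π lam)
    (hp : IsPrincipal (· + ·) lam) {γ x : Ordinal} (hγ : γ < lam) (hx : x < π * lam) :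
    δ + π * γ + x ∈ X ↔ δ + x ∈ X := by
  obtain ⟨_, _, _, _, h5⟩ := h
  obtain ⟨q, hq, r, hr, rfl⟩ := lt_mul_iff.1 hx
  have h1 := h5 (γ + q) (hp hγ hq) r hr
  have h2 := h5 q hq r hr
  rw [mul_add] at h1
  simp only [← add_assoc] at *
  rw [h1, h2]

theorem upw_tail {X : Set Ordinal} {Ω δ π μ τ : Ordinal} (h : UPWith X Ω δ π (μ + τ))
    (hτ : Order.IsSuccLimit τ) : UPWith X Ω (δ + π * μ) π τ := by
  obtain ⟨_, h2, _, h4, h5⟩ := h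
  have hτ0 : 0 < τ := hτ.bot_lt
  refine ⟨?_, h2, hτ, ?_, ?_⟩
  · rw [h4, add_lt_add_iff_left]
    exact mul_lt_mul_of_pos_left (by simpa using hτ0) h2
  · rw [h4, mul_add, add_assoc]
  · intro γ hγ ξ hξ
    have h1 := h5 (μ + γ) (by simpa using hγ) ξ hξ
    have h2 := h5 μ (by simpa using hτ0) ξ hξ
    rw [mul_add, ← add_assoc] at h1
    rw [h1, h2]

theorem upw_mult {X : Set Ordinal} {Ω δ π τ lam : Ordinal} (h : UPWith X Ω δ π (τ * lam))
    (hτ : 0 < τ) (hl : Order.IsSuccLimit lam) : UPWith X Ω δ (π * τ) lam := by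
  obtain ⟨h1, h2, _, h4, h5⟩ := h
  refine ⟨h1, mul_pos h2 hτ, hl, by rw [h4, mul_assoc], ?_⟩
  intro γ hγ ξ hξ
  obtain ⟨q, hq, r, hr, rfl⟩ := lt_mul_iff.1 hξ
  have hlt : τ * γ + q < τ * lam := lt_mul_iff.2 ⟨γ, hγ, q, hq, rfl⟩
  have hqlt : q < τ * lam := lt_of_le_of_lt le_add_self hlt
  have e1 := h5 _ hlt r hr
  have e2 := h5 q hqlt r hr
  rw [mul_add, ← mul_assoc] at e1
  simp only [← add_assoc] at *
  rw [e1, e2]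

theorem exists_tail {lam : Ordinal} (hl : Order.IsSuccLimit lam) :
    ∃ μ σ : Ordinal, σ ≠ 0 ∧ lam = μ + ω ^ σ := by
  have hne : {t : Ordinal | ∃ μ < lam, lam = μ + t}.Nonempty :=
    ⟨lam, 0, hl.bot_lt, by simp⟩
  obtain ⟨μ, hμ, hτ⟩ := WellFounded.min_mem (wellFounded_lt (α := Ordinal)) _ hne
  have hmin : ∀ t, (∃ μ < lam, lam = μ + t) →
      WellFounded.min (wellFounded_lt (α := Ordinal)) _ hne ≤ t := fun t ht =>
    not_lt.1 (WellFounded.not_lt_min _ (s := {t : Ordinal | ∃ μ < lam, lam = μ + t}) ht)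
  generalize WellFounded.min (wellFounded_lt (α := Ordinal)) _ hne = τ at hτ hmin
  have hp : IsPrincipal (· + ·) τ := by
    rw [isPrincipal_add_iff_add_left_eq_self]
    intro a ha
    have e : a + (τ - a) = τ := Ordinal.add_sub_cancel_of_le ha.le
    have : τ ≤ τ - a := hmin _ ⟨μ + a, by rw [hτ]; simpa using ha, by rw [add_assoc, e, hτ]⟩
    have h2 : τ - a ≤ τ := sub_le_self _ _
    have h3 : τ - a = τ := le_antisymm h2 this
    rwa [h3] at e
  rcases isPrincipal_add_iff_zero_or_omega0_opow.1 hp with h0 | ⟨σ, hσ⟩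
  · subst h0; rw [add_zero] at hτ; exact absurd hμ (by simp [hτ])
  · refine ⟨μ, σ, ?_, by rw [hτ, ← hσ]⟩
    rintro rfl
    simp only [opow_zero] at hσ
    rw [hτ, ← hσ] at hl
    exact absurd hl (by simpa using Order.not_isSuccLimit_succ μ)

theorem omega_opow_isLimit {σ : Ordinal} (h : σ ≠ 0) : Order.IsSuccLimit (ω ^ σ) :=
  isSuccLimit_opow_left isSuccLimit_omega0 h

/-- Normal form. -/
theorem upw_normal {X : Set Ordinal} {Ω : Ordinal} (h : UP X Ω) :
    ∃ (δ β σ : Ordinal) (n : ℕ), 0 < n ∧ σ ≠ 0 ∧ (n = 1 ∨ σ = 1) ∧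
      UPWith X Ω δ (ω ^ β * n) (ω ^ σ) := by
  obtain ⟨δ₀, π, lam, h⟩ := h
  obtain ⟨μ, σ, hσ, rfl⟩ := exists_tail h.2.2.1
  have h' := upw_tail h (omega_opow_isLimit hσ)
  generalize δ₀ + π * μ = δ at h'
  clear h
  have hπ : 0 < π := h'.2.1
  set α := log ω π
  have hlo : ω ^ α ≤ π := opow_log_le_self _ hπ.ne'
  have hhi : π < ω ^ α * ω := by
    rw [← opow_succ]; exact lt_opow_succ_log_self one_lt_omega0 π
  have hα : 0 < ω ^ α := opow_pos _ omega0_pos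
  obtain ⟨q, hq, r, hr, hπe⟩ := lt_mul_iff.1 hhi
  obtain ⟨n, rfl⟩ := lt_omega0.1 hq
  have hn : 0 < n := by
    rcases Nat.eq_zero_or_pos n with rfl | h
    · simp at hπe; subst hπe; exact absurd hr (not_lt.2 hlo)
    · exact h
  by_cases h1 : σ = 1
  · subst h1
    refine ⟨δ + ω ^ α * n, α, 1, n, hn, one_ne_zero, Or.inr rfl, ?_⟩
    have hra : r + ω ^ α * n = ω ^ α * n := by
      obtain ⟨m, rfl⟩ := Nat.exists_eq_succ_of_ne_zero hn.ne'
      have : ((m.succ : ℕ) : Ordinal) = 1 + (m : Ordinal) := by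
        rw [← Nat.cast_one, ← Nat.cast_add, Nat.add_comm]
      rw [this, mul_add, mul_one, ← add_assoc,
        (isPrincipal_add_omega0_opow α).add_eq_right hr]
    have hpa : 0 < ω ^ α * (n : Ordinal) := mul_pos hα (by exact_mod_cast hn)
    have hcomm : ∀ γ < ω, ω ^ α * n + ω ^ α * n * γ = π * γ + ω ^ α * n := by
      intro γ hγ
      obtain ⟨k, rfl⟩ := lt_omega0.1 hγ
      clear hγ
      rw [hπe]
      induction k with
      | zero => simp
      | succ k ih =>
        rw [Nat.cast_succ, mul_add_one, mul_add_one, ← add_assoc, ih]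
        rw [add_assoc (_ * _) (_ + r), add_assoc (_ * _) r, hra, add_assoc]
    have hω : ω ^ α * n * ω = ω ^ α * ω := by
      rw [mul_assoc, natCast_mul_omega0 hn]
    have hπω : π * ω = ω ^ α * ω := by
      apply le_antisymm
      · have : π ≤ ω ^ α * ((n + 1 : ℕ) : Ordinal) := by
          rw [hπe, Nat.cast_succ, mul_add_one]
          gcongr
        calc π * ω ≤ ω ^ α * ((n + 1 : ℕ) : Ordinal) * ω := by gcongr
          _ = _ := by rw [mul_assoc, natCast_mul_omega0 n.succ_pos]
      · gcongr
    have hprin : IsPrincipal (· + ·) (ω ^ (1 : Ordinal)) := isPrincipal_add_omega0_opow 1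
    have hΩ := h'.2.2.2.1
    rw [opow_one, hπω] at hΩ
    refine ⟨?_, hpa, omega_opow_isLimit one_ne_zero, ?_, ?_⟩
    · rw [hΩ]
      have : ω ^ α * n < ω ^ α * ω := mul_lt_mul_of_pos_left hq hα
      simpa using this
    · rw [opow_one, hω, hΩ, add_assoc, ← mul_add, natCast_add_omega0]
    · intro γ hγ ξ hξ
      have hγ' : γ < ω := by simpa using hγ
      have key := upw_shift h' hprin hγ (x := ω ^ α * n + ξ) (by
        rw [opow_one, hπω]
        calc ω ^ α * n + ξ < ω ^ α * n + ω ^ α * n := by simpa using hξ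
          _ = ω ^ α * ((n + n : ℕ) : Ordinal) := by rw [Nat.cast_add, mul_add]
          _ < _ := mul_lt_mul_of_pos_left (natCast_lt_omega0 _) hα)
      rw [add_assoc δ, hcomm γ hγ']
      simpa only [add_assoc] using key
  · have hσ1 : 1 ≤ σ := Order.one_le_iff_ne_zero.2 hσ
    have e : 1 + (σ - 1) = σ := Ordinal.add_sub_cancel_of_le hσ1
    have hs : σ - 1 ≠ 0 := by
      intro h0; rw [h0, add_zero] at e; exact h1 e.symm
    refine ⟨δ, α + 1, σ - 1, 1, one_pos, hs, Or.inl rfl, ?_⟩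
    rw [← e, opow_add, opow_one] at h'
    have h2 := upw_mult h' omega0_pos (omega_opow_isLimit hs)
    have hπω : π * ω = ω ^ (α + 1) := by
      rw [opow_add_one]
      apply le_antisymm
      · have : π ≤ ω ^ α * ((n + 1 : ℕ) : Ordinal) := by
          rw [hπe, Nat.cast_succ, mul_add_one]
          gcongr
        calc π * ω ≤ ω ^ α * ((n + 1 : ℕ) : Ordinal) * ω := by gcongr
          _ = _ := by rw [mul_assoc, natCast_mul_omega0 n.succ_pos]
      · gcongr
    rw [hπω] at h2
    simpa using h2

/-- Moving the offset of a set in normal form. -/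
theorem upw_move {X : Set Ordinal} {Ω δ β σ m : Ordinal} {n : ℕ} (hσ : σ ≠ 0)
    (hn0 : 0 < n) (hn : n = 1 ∨ σ = 1)
    (h : UPWith X Ω δ (ω ^ β * n) (ω ^ σ)) (hm : m < ω ^ σ) :
    UPWith X Ω (δ + ω ^ β * m) (ω ^ β * n) (ω ^ σ) := by
  have hprin := isPrincipal_add_omega0_opow σ
  rcases hn with rfl | rfl
  · have e := hprin.add_eq_right hm
    rw [← e] at h
    have h' := upw_tail h (omega_opow_isLimit hσ)
    simpa using h'
  · have hβ : 0 < ω ^ β := opow_pos _ omega0_pos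
    obtain ⟨k, rfl⟩ := lt_omega0.1 (by simpa using hm)
    obtain ⟨h1, h2, h3, h4, h5⟩ := id h
    rw [opow_one, mul_assoc, natCast_mul_omega0 hn0] at h4
    refine ⟨?_, h2, h3, ?_, ?_⟩
    · have : ω ^ β * k < ω ^ β * ω := mul_lt_mul_of_pos_left (natCast_lt_omega0 _) hβ
      rw [h4]; simpa using this
    · rw [h4, opow_one, mul_assoc, natCast_mul_omega0 hn0, add_assoc, ← mul_add,
        natCast_add_omega0]
    · intro γ hγ ξ hξ
      have key := upw_shift h hprin hγ (x := ω ^ β * k + ξ) (by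
        rw [opow_one, mul_assoc, natCast_mul_omega0 hn0]
        calc ω ^ β * k + ξ < ω ^ β * k + ω ^ β * n := by simpa using hξ
          _ = ω ^ β * ((k + n : ℕ) : Ordinal) := by rw [Nat.cast_add, mul_add]
          _ < _ := mul_lt_mul_of_pos_left (natCast_lt_omega0 _) hβ)
      obtain ⟨l, rfl⟩ := lt_omega0.1 (by simpa using hγ)
      have e : ω ^ β * k + ω ^ β * n * l = ω ^ β * n * l + ω ^ β * k := by
        rw [mul_assoc, ← mul_add, ← mul_add]
        congr 1
        exact_mod_cast Nat.add_comm k (n * l)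
      rw [add_assoc δ, e]
      simpa only [add_assoc] using key

theorem exp_unique_aux {δ δ' ρ ρ' : Ordinal} (h : δ + ω ^ ρ = δ' + ω ^ ρ') (hle : δ ≤ δ')
    : ρ = ρ' := by
  have e : δ + (δ' - δ) = δ' := Ordinal.add_sub_cancel_of_le hle
  rw [← e, add_assoc, add_left_cancel_iff] at h
  have h1 : ω ^ ρ' ≤ ω ^ ρ := h ▸ le_add_self
  have hpos : 0 < ω ^ ρ' := opow_pos _ omega0_pos
  have h2 : δ' - δ < ω ^ ρ := by
    conv_rhs => rw [h]
    simpa using hpos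
  have h3 : ¬ ω ^ ρ' < ω ^ ρ := fun hlt =>
    absurd (isPrincipal_add_omega0_opow ρ h2 hlt) (by simp [← h])
  have h4 := le_antisymm h1 (not_lt.1 h3)
  exact ((opow_right_inj one_lt_omega0).1 h4).symm

theorem exp_unique {δ δ' ρ ρ' : Ordinal} (h : δ + ω ^ ρ = δ' + ω ^ ρ') : ρ = ρ' := by
  rcases le_total δ δ' with hle | hle
  · exact exp_unique_aux h hle
  · exact (exp_unique_aux h.symm hle).symm

/-- `ω ^ β * n * ω ^ σ = ω ^ (β + σ)`. -/
theorem prod_eq {β σ : Ordinal} {n : ℕ} (hn : 0 < n) (hσ : σ ≠ 0) :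
    ω ^ β * n * ω ^ σ = ω ^ (β + σ) := by
  rw [opow_add, mul_assoc, mul_omega0_dvd (by exact_mod_cast hn) (natCast_lt_omega0 n)
    (isSuccLimit_iff_omega0_dvd.1 (omega_opow_isLimit hσ)).2]

/-- Common offset once the period agrees. -/
theorem upw_common_offset {X Y : Set Ordinal} {Ω δ δ' β σ : Ordinal} {n : ℕ} (hσ : σ ≠ 0)
    (hn0 : 0 < n) (hn : n = 1 ∨ σ = 1)
    (hX : UPWith X Ω δ (ω ^ β * n) (ω ^ σ)) (hY : UPWith Y Ω δ' (ω ^ β * n) (ω ^ σ)) :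
    ∃ d p l, UPWith X Ω d p l ∧ UPWith Y Ω d p l := by
  have hβ : 0 < ω ^ β := opow_pos _ omega0_pos
  have eX : Ω = δ + ω ^ β * ω ^ σ := by rw [hX.2.2.2.1, prod_eq hn0 hσ, opow_add]
  have eY : Ω = δ' + ω ^ β * ω ^ σ := by rw [hY.2.2.2.1, prod_eq hn0 hσ, opow_add]
  have hlim := omega_opow_isLimit hσ
  obtain ⟨x, hx, hx'⟩ := (lt_add_iff (mul_pos hβ hlim.bot_lt).ne').1 (eX ▸ hY.1)
  obtain ⟨m, hm, r, hr, rfl⟩ := lt_mul_iff.1 hx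
  have hle : δ' ≤ δ + ω ^ β * (m + 1) := by
    refine hx'.trans ?_
    rw [mul_add_one]
    gcongr
  obtain ⟨ε, hε⟩ := exists_add_of_le hle
  have hm1 : m + 1 + 1 < ω ^ σ := by
    simpa using hlim.succ_lt (hlim.succ_lt hm)
  have e2 : ε + ω ^ β = ω ^ β * (ε / ω ^ β + 1) := by
    conv_lhs => rw [← div_add_mod ε (ω ^ β)]
    rw [add_assoc, (isPrincipal_add_omega0_opow β).add_eq_right (mod_lt _ hβ.ne'), mul_add_one]
  have e3 : δ + ω ^ β * (m + 1 + 1) = δ' + ω ^ β * (ε / ω ^ β + 1) := by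
    rw [← e2, ← add_assoc, ← hε, mul_add_one _ (m + 1), add_assoc]
  have hq : ε / ω ^ β + 1 < ω ^ σ := by
    have : δ + ω ^ β * (m + 1 + 1) < Ω := by
      rw [eX, add_lt_add_iff_left]
      exact mul_lt_mul_of_pos_left hm1 hβ
    rw [e3, eY, add_lt_add_iff_left] at this
    exact (mul_lt_mul_iff_right₀ hβ).1 this
  have A := upw_move hσ hn0 hn hX hm1
  have B := upw_move hσ hn0 hn hY hq
  rw [← e3] at B
  exact ⟨_, _, _, A, B⟩

theorem upw_common_aux {X Y : Set Ordinal} {Ω δ δ' β β' σ σ' : Ordinal} {n n' : ℕ}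
    (hσ : σ ≠ 0) (hn0 : 0 < n) (hn : n = 1 ∨ σ = 1)
    (hσ' : σ' ≠ 0) (hn0' : 0 < n') (hn' : n' = 1 ∨ σ' = 1)
    (hX : UPWith X Ω δ (ω ^ β * n) (ω ^ σ)) (hY : UPWith Y Ω δ' (ω ^ β' * n') (ω ^ σ'))
    (hle : β' ≤ β) :
    ∃ d p l, UPWith X Ω d p l ∧ UPWith Y Ω d p l := by
  have hρ : β + σ = β' + σ' := by
    have h1 := hX.2.2.2.1
    have h2 := hY.2.2.2.1
    rw [prod_eq hn0 hσ] at h1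
    rw [prod_eq hn0' hσ'] at h2
    exact exp_unique (h1.symm.trans h2)
  rcases hle.eq_or_lt with rfl | hlt
  · obtain rfl := add_left_cancel hρ
    have key : ∀ k : ℕ, 0 < k → (k : Ordinal) * ω ^ σ = ω ^ σ := fun k hk =>
      mul_omega0_dvd (by exact_mod_cast hk) (natCast_lt_omega0 k)
        (isSuccLimit_iff_omega0_dvd.1 (omega_opow_isLimit hσ)).2
    rw [← key n' hn0'] at hX
    rw [← key n hn0] at hY
    have A := upw_mult hX (by exact_mod_cast hn0') (omega_opow_isLimit hσ)
    have B := upw_mult hY (by exact_mod_cast hn0) (omega_opow_isLimit hσ)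
    rw [mul_assoc, ← natCast_mul] at A B
    rw [Nat.mul_comm] at B
    refine upw_common_offset hσ (Nat.mul_pos hn0 hn0') ?_ A B
    rcases hn with rfl | h
    · rcases hn' with rfl | h
      · exact Or.inl rfl
      · exact Or.inr h
    · exact Or.inr h
  · have e : β' + (β - β') = β := Ordinal.add_sub_cancel_of_le hle
    have hσ'1 : σ' ≠ 1 := by
      rintro rfl
      have h1 : β < β + σ := by simpa using pos_iff_ne_zero.2 hσ
      rw [hρ] at h1
      have h2 : β ≤ β' := Order.lt_succ_iff.1 (by simpa using h1)
      exact absurd hlt (not_lt.2 h2)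
    obtain rfl : n' = 1 := hn'.resolve_right hσ'1
    have e' : σ' = (β - β') + σ := by
      rw [← e, add_assoc] at hρ
      exact (add_left_cancel hρ).symm
    rw [e', opow_add, Nat.cast_one, mul_one] at hY
    have B := upw_mult hY (opow_pos _ omega0_pos) (omega_opow_isLimit hσ)
    rw [← opow_add, e] at B
    have key : (n : Ordinal) * ω ^ σ = ω ^ σ :=
      mul_omega0_dvd (by exact_mod_cast hn0) (natCast_lt_omega0 n)
        (isSuccLimit_iff_omega0_dvd.1 (omega_opow_isLimit hσ)).2
    rw [← key] at B
    have C := upw_mult B (by exact_mod_cast hn0) (omega_opow_isLimit hσ)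
    exact upw_common_offset hσ hn0 hn hX C

theorem upw_common {X Y : Set Ordinal} {Ω : Ordinal} (hX : UP X Ω) (hY : UP Y Ω) :
    ∃ d p l, UPWith X Ω d p l ∧ UPWith Y Ω d p l := by
  obtain ⟨δ, β, σ, n, h1, h2, h3, h4⟩ := upw_normal hX
  obtain ⟨δ', β', σ', n', h1', h2', h3', h4'⟩ := upw_normal hY
  rcases le_total β' β with h | h
  · exact upw_common_aux h2 h1 h3 h2' h1' h3' h4 h4' h
  · obtain ⟨d, p, l, A, B⟩ := upw_common_aux h2' h1' h3' h2 h1 h3 h4' h4 h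
    exact ⟨d, p, l, B, A⟩

/-- The ultimately periodic subsets of `Ω` are closed under the boolean operations. -/
theorem up_closed_boolean (Ω : Ordinal) (X Y : Set Ordinal)
    (hXsub : X ⊆ Set.Iio Ω) (hYsub : Y ⊆ Set.Iio Ω)
    (hX : UP X Ω) (hY : UP Y Ω) :
    UP (X ∪ Y) Ω ∧ UP (X ∩ Y) Ω ∧ UP (Set.Iio Ω \ X) Ω := by
  obtain ⟨d, p, l, A, B⟩ := upw_common hX hY
  obtain ⟨a1, a2, a3, a4, a5⟩ := A
  obtain ⟨_, _, _, _, b5⟩ := B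
  refine ⟨⟨d, p, l, a1, a2, a3, a4, ?_⟩, ⟨d, p, l, a1, a2, a3, a4, ?_⟩,
    ⟨d, p, l, a1, a2, a3, a4, ?_⟩⟩
  · intro γ hγ ξ hξ
    simp only [Set.mem_union, a5 γ hγ ξ hξ, b5 γ hγ ξ hξ]
  · intro γ hγ ξ hξ
    simp only [Set.mem_inter_iff, a5 γ hγ ξ hξ, b5 γ hγ ξ hξ]
  · intro γ hγ ξ hξ
    have hlt : ∀ γ < l, d + p * γ + ξ < Ω := by
      intro γ hγ
      rw [a4, add_assoc, add_lt_add_iff_left]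
      exact lt_mul_iff.2 ⟨γ, hγ, ξ, hξ, rfl⟩
    have h0 : d + ξ < Ω := by simpa using hlt 0 a3.bot_lt
    simp only [Set.mem_diff, Set.mem_Iio, a5 γ hγ ξ hξ, hlt γ hγ, h0]
end

section
/- For all ordinals α, β and every set A ⊆ β: A ∈ H₀(β) if and only if {α + x : x ∈ A} ∈ H₀(α + β). -/
open Ordinal Set Filter

theorem mem_translate (α γ x : Ordinal) (A : Set Ordinal) :
    (α + x ∈ (fun x => α + x) '' A ∩ Set.Iio (α + γ)) ↔ x ∈ A ∩ Set.Iio γ := by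
  simp

theorem UP_translate_iff (α γ : Ordinal) (A : Set Ordinal) :
    UP (A ∩ Set.Iio γ) γ ↔ 0 < γ ∧ UP ((fun x => α + x) '' A ∩ Set.Iio (α + γ)) (α + γ) := by
  constructor
  · rintro ⟨δ, π, lam, h1, h2, h3, h4, h5⟩
    refine ⟨lt_of_le_of_lt zero_le h1, α + δ, π, lam, by simpa using h1, h2, h3, ?_, ?_⟩
    · rw [add_assoc, ← h4]
    · intro c hc ξ hξ
      have := h5 c hc ξ hξ
      rw [← mem_translate α, ← mem_translate α γ (δ + ξ)] at this
      simpa only [add_assoc] using this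
  · rintro ⟨h0, δ, π, lam, h1, h2, h3, h4, h5⟩
    have hlt : α < δ + π * lam := by rw [← h4]; simpa using h0
    obtain ⟨ν, hν, hαν⟩ : ∃ ν < lam, α ≤ δ + π * ν := by
      by_contra! hcon
      have : δ + π * lam ≤ α := by
        rcases le_total δ α with h | h
        · obtain ⟨a, rfl⟩ : ∃ a, α = δ + a := ⟨α - δ, (Ordinal.add_sub_cancel_of_le h).symm⟩
          have h6 : π * lam ≤ a := by
            rw [(Ordinal.isNormal_mul_right h2).le_iff_forall_le h3]
            intro b hb
            have := hcon b hb
            simpa using this.le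
          simpa using h6
        · have := hcon 0 h3.bot_lt
          simp at this
          exact absurd this (not_lt.2 h)
      exact absurd this (not_le.2 hlt)
    obtain ⟨d, hd⟩ : ∃ d, δ + π * ν = α + d := ⟨_, (Ordinal.add_sub_cancel_of_le hαν).symm⟩
    obtain ⟨l, rfl⟩ : ∃ l, lam = ν + l := ⟨_, (Ordinal.add_sub_cancel_of_le hν.le).symm⟩
    have hl0 : 0 < l := by simpa using hν
    have hl : Order.IsSuccLimit l := by
      have := Ordinal.isSuccLimit_sub h3.isSuccPrelimit hν
      simpa using this
    have hγ : γ = d + π * l := by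
      rw [mul_add, ← add_assoc, hd, add_assoc] at h4
      simpa using h4
    refine ⟨d, π, l, ?_, h2, hl, hγ, ?_⟩
    · rw [hγ]; simpa using mul_pos h2 hl0
    · intro c hc ξ hξ
      have e1 := h5 (ν + c) (by simpa using hc) ξ hξ
      have e2 := h5 ν hν ξ hξ
      rw [mul_add, ← add_assoc, hd] at e1
      rw [hd] at e2
      have := e1.trans e2.symm
      simp only [add_assoc] at this
      rw [mem_translate, mem_translate] at this
      simpa only [add_assoc] using this

/-- `A ∈ H₀(β)` iff the left translate `{α + x : x ∈ A}` belongs to `H₀(α + β)`. -/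
theorem H0_translate_iff (α β : Ordinal) (A : Set Ordinal) (hA : A ⊆ Set.Iio β) :
    A ∈ H0 β ↔ (fun x => α + x) '' A ∈ H0 (α + β) := by
  constructor
  · rintro ⟨-, h⟩
    refine ⟨?_, ?_⟩
    · rintro _ ⟨x, hx, rfl⟩
      simpa using hA hx
    · intro b hb hlim
      rcases le_or_gt b α with hba | hba
      · have he : (fun x => α + x) '' A ∩ Set.Iio b = ∅ := by
          ext y
          simp only [mem_inter_iff, mem_image, mem_Iio, mem_empty_iff_false, iff_false]
          rintro ⟨⟨x, -, rfl⟩, hy⟩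
          exact absurd (hba.trans le_self_add) (not_le.2 hy)
        rw [he]
        exact ⟨0, 1, b, hlim.bot_lt, zero_lt_one, hlim, by simp, by simp⟩
      · obtain ⟨g, rfl⟩ : ∃ g, b = α + g := ⟨_, (Ordinal.add_sub_cancel_of_le hba.le).symm⟩
        have hg : Order.IsSuccLimit g := by
          have := Ordinal.isSuccLimit_sub hlim.isSuccPrelimit hba
          simpa using this
        exact ((UP_translate_iff α g A).1 (h g (by simpa using hb) hg)).2
  · rintro ⟨-, h⟩
    refine ⟨hA, fun g hg hlim => ?_⟩
    exact (UP_translate_iff α g A).2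
      ⟨hlim.bot_lt, h (α + g) (by simpa using hg) (Ordinal.isSuccLimit_add α hlim)⟩
end

section
/- (Concatenation) If A ∈ H₀(α) and B ∈ H₀(β), then A ∪ {α + x : x ∈ B} ∈ H₀(α + β). -/
open Ordinal Set Filter

/-- Concatenation: if `A ∈ H₀(α)` and `B ∈ H₀(β)` then
`A ∪ {α + x : x ∈ B} ∈ H₀(α + β)`. -/
theorem H0_concat (α β : Ordinal) (A B : Set Ordinal)
    (hA : A ∈ H0 α) (hB : B ∈ H0 β) :
    A ∪ ((fun x => α + x) '' B) ∈ H0 (α + β) := by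
  obtain ⟨hA1, hA2⟩ := hA
  obtain ⟨hB1, hB2⟩ := hB
  refine ⟨?_, ?_⟩
  · rintro x (hx | ⟨y, hy, rfl⟩)
    · exact lt_of_lt_of_le (Set.mem_Iio.1 (hA1 hx)) le_self_add
    · exact (add_lt_add_iff_left α).2 (hB1 hy)
  intro γ hγ hlim
  rcases le_or_gt γ α with h | h
  · have e : (A ∪ ((fun x => α + x) '' B)) ∩ Set.Iio γ = A ∩ Set.Iio γ := by
      ext x
      constructor
      · rintro ⟨hx | ⟨y, hy, rfl⟩, hx2⟩
        · exact ⟨hx, hx2⟩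
        · exact absurd (lt_of_lt_of_le hx2 h) (not_lt.2 le_self_add)
      · rintro ⟨hx, hx2⟩
        exact ⟨Or.inl hx, hx2⟩
    rw [e]
    exact hA2 γ h hlim
  · obtain ⟨c, rfl⟩ := exists_add_of_le h.le
    have hc0 : c ≠ 0 := by
      rintro rfl
      simp at h
    have hcβ : c ≤ β := (add_le_add_iff_left α).1 hγ
    have hc : Order.IsSuccLimit c := by
      rw [Ordinal.isSuccLimit_iff] at hlim ⊢
      refine ⟨hc0, ?_⟩
      rw [Order.isSuccPrelimit_iff_succ_lt] at *
      intro a ha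
      have := hlim.2 (α + a) ((add_lt_add_iff_left α).2 ha)
      rw [← Ordinal.add_succ] at this
      exact (add_lt_add_iff_left α).1 this
    have key : ∀ y, α + y ∈ (A ∪ ((fun x => α + x) '' B)) ∩ Set.Iio (α + c) ↔
        y ∈ B ∩ Set.Iio c := by
      intro y
      constructor
      · rintro ⟨hx | ⟨z, hz, hzy⟩, hx2⟩
        · exact absurd (Set.mem_Iio.1 (hA1 hx)) (not_lt.2 le_self_add)
        · have : z = y := add_left_cancel hzy
          subst this
          exact ⟨hz, (add_lt_add_iff_left α).1 hx2⟩
      · rintro ⟨hx, hx2⟩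
        exact ⟨Or.inr ⟨y, hx, rfl⟩, (add_lt_add_iff_left α).2 hx2⟩
    obtain ⟨δ, π, lam, h1, h2, h3, h4, h5⟩ := hB2 c hcβ hc
    refine ⟨α + δ, π, lam, (add_lt_add_iff_left α).2 h1, h2, h3, ?_, ?_⟩
    · rw [add_assoc, ← h4]
    · intro g hg ξ hξ
      have := h5 g hg ξ hξ
      rw [← key, ← key] at this
      simpa only [add_assoc] using this
end

section
/- (Iteration) If A ∈ H₀(β), then for every ordinal δ > 0 the set {β·γ + ξ : γ < δ and ξ ∈ A} belongs to H₀(β·δ). -/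
open Ordinal Set Filter

theorem mem_iter_aux {β : Ordinal} {A : Set Ordinal} (hA : A ⊆ Set.Iio β) {δ q x : Ordinal}
    (hq : q < δ) (hx : x < β) :
    β * q + x ∈ {x : Ordinal | ∃ γ < δ, ∃ ξ ∈ A, x = β * γ + ξ} ↔ x ∈ A := by
  constructor
  · rintro ⟨γ, _, ξ, hξ, h⟩
    have h1 := congrArg (· % β) h
    simp only [Ordinal.mul_add_mod_self, Ordinal.mod_eq_of_lt hx,
      Ordinal.mod_eq_of_lt (show ξ < β from hA hξ)] at h1
    rwa [h1]
  · intro h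
    exact ⟨q, hq, x, h, rfl⟩

theorem up_shift_aux {β : Ordinal} {A : Set Ordinal} (hA : A ∈ H0 β) {δ q r : Ordinal}
    (hq : q < δ) (hr : r ≤ β) (hl : Order.IsSuccLimit r) :
    UP ({x : Ordinal | ∃ γ < δ, ∃ ξ ∈ A, x = β * γ + ξ} ∩ Set.Iio (β * q + r)) (β * q + r) := by
  have key : ∀ x, β * q + x ∈
      ({x : Ordinal | ∃ γ < δ, ∃ ξ ∈ A, x = β * γ + ξ} ∩ Set.Iio (β * q + r)) ↔
      x ∈ A ∩ Set.Iio r := by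
    intro x
    simp only [Set.mem_inter_iff, Set.mem_Iio, add_lt_add_iff_left]
    exact and_congr_left fun h => mem_iter_aux hA.1 hq (h.trans_le hr)
  obtain ⟨d, p, l, h1, h2, h3, h4, h5⟩ := hA.2 r hr hl
  refine ⟨β * q + d, p, l, by simpa using h1, h2, h3, by rw [add_assoc, ← h4], ?_⟩
  intro γ hγ ξ hξ
  rw [add_assoc (β * q) d, add_assoc (β * q), add_assoc (β * q) d, key, key]
  exact h5 γ hγ ξ hξ

/-- Iteration: if `A ∈ H₀(β)` then for every `δ > 0` the set
`{β·γ + ξ : γ < δ, ξ ∈ A}` belongs to `H₀(β·δ)`. -/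
theorem H0_iterate (β : Ordinal) (A : Set Ordinal) (hA : A ∈ H0 β) :
    ∀ δ : Ordinal, 0 < δ →
      {x : Ordinal | ∃ γ < δ, ∃ ξ ∈ A, x = β * γ + ξ} ∈ H0 (β * δ) := by
  intro δ hδ
  rcases eq_or_ne β 0 with rfl | hβ
  · refine ⟨?_, fun ε hε hl => ?_⟩
    · rintro x ⟨γ, _, ξ, hξ, _⟩
      exact absurd (hA.1 hξ) (by simp)
    · simp only [zero_mul, nonpos_iff_eq_zero] at hε
      subst hε
      simp at hl
  have hβ0 : 0 < β := pos_iff_ne_zero.2 hβ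
  have hlt : ∀ {γ η ξ : Ordinal}, γ < η → ξ < β → β * γ + ξ < β * η := by
    intro γ η ξ h h'
    calc β * γ + ξ < β * γ + β := by simpa using h'
      _ = β * (γ + 1) := by rw [mul_add, mul_one]
      _ ≤ β * η := by gcongr; exact Order.add_one_le_of_lt h
  refine ⟨?_, fun ε hε hl => ?_⟩
  · rintro x ⟨γ, hγ, ξ, hξ, rfl⟩
    exact hlt hγ (hA.1 hξ)
  have hdm := Ordinal.div_add_mod ε β
  have hr := Ordinal.mod_lt ε hβ
  generalize ε / β = q at hdm
  generalize ε % β = r at hdm hr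
  subst hdm
  have hl0 := hl
  rcases Ordinal.isSuccLimit_add_iff.1 hl with h | ⟨rfl, h⟩
  · have hq : q < δ := by
      by_contra hn
      have h2 : β * δ ≤ β * q := by gcongr; exact not_lt.1 hn
      have h3 : β * q + r ≤ β * q + 0 := by simpa using hε.trans h2
      have h4 := (add_le_add_iff_left _).1 h3
      simp only [nonpos_iff_eq_zero] at h4
      subst h4
      simp at h
    exact up_shift_aux hA hq hr.le h
  · rw [add_zero] at *
    have hqδ : q ≤ δ := by
      by_contra hn
      have := hlt (not_le.1 hn) hβ0
      rw [add_zero] at this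
      exact absurd hε (not_le.2 this)
    rcases Ordinal.zero_or_succ_or_isSuccLimit q with rfl | ⟨q, rfl⟩ | hq
    · simp at h
    · have hq : q < δ := Order.succ_le_iff.1 hqδ
      rw [Order.succ_eq_add_one, mul_add, mul_one] at h ⊢
      rcases Ordinal.isSuccLimit_add_iff.1 h with h | ⟨h, _⟩
      · exact up_shift_aux hA hq le_rfl h
      · exact absurd h hβ
    · refine ⟨0, β, q, ?_, hβ0, hq, by simp, ?_⟩
      · exact pos_iff_ne_zero.2 (by rintro h0; rw [h0] at h; simp at h)
      · intro γ hγ ξ hξ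
        have h1 := mem_iter_aux hA.1 (hγ.trans_le hqδ) hξ
        have h2 := mem_iter_aux hA.1 hδ hξ
        have h3 := hlt hγ hξ
        have h4 := hlt (pos_iff_ne_zero.2 (show q ≠ 0 by rintro rfl; simp at hq)) hξ
        rw [mul_zero, zero_add] at h2 h4
        simp only [zero_add, Set.mem_inter_iff, Set.mem_Iio, h1, h2, h3, h4]
end

section
/- For every ordinal Ω, H₀(Ω) is closed under the topological derivative: if X ∈ H₀(Ω), then d₀(X) ∩ Ω ∈ H₀(Ω). -/
open Ordinal Set Filter

theorem mem_d0_iff (X : Set Ordinal) (x : Ordinal) :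
    x ∈ d0 X ↔ x ≠ 0 ∧ ∀ p < x, ∃ y ∈ X, p < y ∧ y < x := by
  have h : x ∈ d0 X ↔ Ordinal.IsAcc x X := Iff.rfl
  rw [h, Ordinal.isAcc_iff]
  constructor
  · rintro ⟨h1, h2⟩
    refine ⟨h1, fun p hp => ?_⟩
    obtain ⟨y, hy, hy1, hy2⟩ := h2 p hp
    exact ⟨y, hy, hy1, hy2⟩
  · rintro ⟨h1, h2⟩
    refine ⟨h1, fun p hp => ?_⟩
    obtain ⟨y, hy, hy1, hy2⟩ := h2 p hp
    exact ⟨y, hy, hy1, hy2⟩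

theorem d0_shift_aux (X : Set Ordinal) (b b' ζ : Ordinal) (hζ : 0 < ζ)
    (h : ∀ η < ζ, (b + η ∈ X ↔ b' + η ∈ X)) (hd : b + ζ ∈ d0 X) : b' + ζ ∈ d0 X := by
  rw [mem_d0_iff] at hd ⊢
  obtain ⟨-, hd⟩ := hd
  refine ⟨(lt_of_lt_of_le hζ le_add_self).ne', fun p hp => ?_⟩
  have hq : ∃ q < ζ, p ≤ b' + q := by
    rcases le_total p b' with h1 | h1
    · exact ⟨0, hζ, by simpa using h1⟩
    · refine ⟨p - b', ?_, ?_⟩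
      · rw [← add_lt_add_iff_left b', Ordinal.add_sub_cancel_of_le h1]; exact hp
      · rw [Ordinal.add_sub_cancel_of_le h1]
  obtain ⟨q, hq, hpq⟩ := hq
  obtain ⟨y, hy, hy1, hy2⟩ := hd (b + q) (by simpa using hq)
  have hby : b ≤ y := le_trans le_self_add hy1.le
  obtain ⟨η, rfl⟩ : ∃ η, y = b + η := ⟨y - b, (Ordinal.add_sub_cancel_of_le hby).symm⟩
  simp only [add_lt_add_iff_left] at hy1 hy2
  exact ⟨b' + η, (h η hy2).1 hy, lt_of_le_of_lt hpq (by simpa using hy1), by simpa using hy2⟩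

theorem d0_shift (X : Set Ordinal) (b b' ζ : Ordinal) (hζ : 0 < ζ)
    (h : ∀ η < ζ, (b + η ∈ X ↔ b' + η ∈ X)) : b + ζ ∈ d0 X ↔ b' + ζ ∈ d0 X :=
  ⟨d0_shift_aux X b b' ζ hζ h, d0_shift_aux X b' b ζ hζ fun η hη => (h η hη).symm⟩

theorem mul_add_lt_mul {π γ ξ lam : Ordinal} (hγ : γ < lam) (hξ : ξ < π) :
    π * γ + ξ < π * lam := by
  calc π * γ + ξ < π * γ + π := by simpa using hξ
    _ = π * (Order.succ γ) := by rw [Ordinal.mul_succ]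
    _ ≤ π * lam := by gcongr; exact Order.succ_le_of_lt hγ

theorem d0_limit (X : Set Ordinal) (δ π lam : Ordinal) (hπ : 0 < π)
    (h : ∀ γ < lam, ∀ ξ < π, (δ + π * γ + ξ ∈ X ↔ δ + ξ ∈ X))
    (g : Ordinal) (hg : Order.IsSuccLimit g) (hgl : g ≤ lam) :
    δ + π * g ∈ d0 X ↔ ∃ r < π, δ + r ∈ X := by
  have hg0 : 0 < g := hg.bot_lt
  have hpos : 0 < π * g := mul_pos hπ hg0
  rw [mem_d0_iff]
  constructor
  · rintro ⟨-, hd⟩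
    obtain ⟨y, hy, hy1, hy2⟩ := hd δ (by simpa using hpos)
    obtain ⟨η, rfl⟩ : ∃ η, y = δ + η := ⟨y - δ, (Ordinal.add_sub_cancel_of_le hy1.le).symm⟩
    simp only [add_lt_add_iff_left] at hy2
    have hdm := Ordinal.div_add_mod η π
    have hlt : η / π < g := (Ordinal.div_lt hπ.ne').2 hy2
    refine ⟨η % π, Ordinal.mod_lt _ hπ.ne', ?_⟩
    rw [← h (η / π) (hlt.trans_le hgl) _ (Ordinal.mod_lt _ hπ.ne'), add_assoc, hdm]
    exact hy
  · rintro ⟨r, hr, hrX⟩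
    refine ⟨(lt_of_lt_of_le hpos le_add_self).ne', fun p hp => ?_⟩
    have hq : ∃ q < g, p < δ + π * q := by
      rcases lt_or_ge p δ with h1 | h1
      · exact ⟨0, hg0, by simpa using h1⟩
      · have h2 : p - δ < π * g := by
          rw [← add_lt_add_iff_left δ, Ordinal.add_sub_cancel_of_le h1]; exact hp
        have hlt : (p - δ) / π < g := (Ordinal.div_lt hπ.ne').2 h2
        refine ⟨Order.succ ((p - δ) / π), hg.succ_lt hlt, ?_⟩
        conv_lhs => rw [← Ordinal.add_sub_cancel_of_le h1]
        simpa using Ordinal.lt_mul_succ_div (p - δ) hπ.ne'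
    obtain ⟨q, hq, hpq⟩ := hq
    refine ⟨δ + π * q + r, (h q (hq.trans_le hgl) r hr).2 hrX, lt_of_lt_of_le hpq le_self_add, ?_⟩
    rw [add_assoc]
    simpa using mul_add_lt_mul hq hr

theorem per_ext (X : Set Ordinal) (δ π lam : Ordinal) (hπ : 0 < π)
    (hl : Order.IsSuccLimit lam)
    (h : ∀ γ < lam, ∀ ξ < π, (δ + π * γ + ξ ∈ X ↔ δ + ξ ∈ X))
    (γ : Ordinal) (hγ : γ < lam) (η : Ordinal) (hη : η < π * ω) :
    δ + π * γ + η ∈ X ↔ δ + η % π ∈ X := by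
  have hlt : η / π < ω := (Ordinal.div_lt hπ.ne').2 hη
  obtain ⟨n, hn⟩ := Ordinal.lt_omega0.1 hlt
  have hm := Ordinal.mod_lt η hπ.ne'
  have hgn : γ + n < lam := by
    clear hn
    induction n with
    | zero => simpa using hγ
    | succ n ih =>
      have := hl.succ_lt ih
      rw [← Order.succ_eq_add_one] at *
      simpa [add_assoc] using this
  rw [← h (γ + n) hgn _ hm, mul_add, ← hn]
  conv_lhs => rw [← Ordinal.div_add_mod η π]
  simp only [add_assoc]

theorem UP_d0 (X : Set Ordinal) (β : Ordinal) (hX : UP (X ∩ Iio β) β) : UP (d0 X ∩ Iio β) β := by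
  obtain ⟨δ, π, lam, hδ, hπ, hl, hβ, h⟩ := hX
  have h : ∀ γ < lam, ∀ ξ < π, (δ + π * γ + ξ ∈ X ↔ δ + ξ ∈ X) := by
    intro γ hγ ξ hξ
    have h1 := h γ hγ ξ hξ
    have a1 : δ + π * γ + ξ < β := by
      rw [hβ, add_assoc]; simpa using mul_add_lt_mul hγ hξ
    have a2 : δ + ξ < β := by
      rw [hβ]; simpa using mul_add_lt_mul (γ := 0) hl.bot_lt hξ
    simpa [a1, a2] using h1
  -- it suffices to have periodicity of `d0 X`
  suffices H : ∃ δ' π' l', 0 < π' ∧ Order.IsSuccLimit l' ∧ β = δ' + π' * l' ∧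
      ∀ γ < l', ∀ ξ < π', (δ' + π' * γ + ξ ∈ d0 X ↔ δ' + ξ ∈ d0 X) by
    obtain ⟨δ', π', l', hπ', hl', hβ', h'⟩ := H
    refine ⟨δ', π', l', ?_, hπ', hl', hβ', ?_⟩
    · rw [hβ']; simpa using mul_pos hπ' hl'.bot_lt
    · intro γ hγ ξ hξ
      have a1 : δ' + π' * γ + ξ < β := by
        rw [hβ', add_assoc]; simpa using mul_add_lt_mul hγ hξ
      have a2 : δ' + ξ < β := by
        rw [hβ']; simpa using mul_add_lt_mul (γ := 0) hl'.bot_lt hξ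
      simpa [a1, a2] using h' γ hγ ξ hξ
  have P := per_ext X δ π lam hπ hl h
  obtain ⟨ν, hν⟩ : ω ∣ lam := (Ordinal.isSuccLimit_iff_omega0_dvd.1 hl).2
  have hω : (0 : Ordinal) < ω := Ordinal.omega0_pos
  rcases Ordinal.zero_or_succ_or_isSuccLimit ν with h0 | ⟨κ, hκ⟩ | hνl
  · subst h0
    exact absurd hl.bot_lt (by simp [hν])
  · have hlam : lam = ω * κ + ω := by rw [hν, ← hκ, Ordinal.mul_succ]
    refine ⟨δ + π * (ω * κ + 1), π, ω, hπ, Ordinal.isSuccLimit_omega0, ?_, ?_⟩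
    · rw [hβ, add_assoc, ← mul_add, add_assoc, Ordinal.one_add_omega0, hlam]
    · intro γ hγ ξ hξ
      have e1 : δ + π * (ω * κ + 1) + π * γ + ξ = δ + π * (ω * κ + γ) + (π + ξ) := by
        obtain ⟨n, rfl⟩ := Ordinal.lt_omega0.1 hγ
        have : (1 : Ordinal) + n = n + 1 := by exact_mod_cast add_comm 1 n
        rw [add_assoc δ, ← mul_add, add_assoc (ω * κ), this, ← add_assoc (ω * κ), mul_add π _ 1,
          mul_one]
        simp only [add_assoc]
      have e2 : δ + π * (ω * κ + 1) + ξ = δ + π * (ω * κ) + (π + ξ) := by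
        rw [mul_add π _ 1, mul_one]
        simp only [add_assoc]
      rw [e1, e2]
      apply d0_shift _ _ _ _ (lt_of_lt_of_le hπ le_self_add)
      intro η hη
      have hη' : η < π * ω := by
        refine hη.trans ?_
        have := mul_add_lt_mul (Ordinal.one_lt_omega0) hξ
        simpa using this
      rw [P _ (by rw [hlam]; simpa using hγ) _ hη', P _ (by rw [hlam]; simpa using hω) _ hη']
  · have h1ν : 1 + ν = ν := Ordinal.one_add_of_omega0_le (Ordinal.omega0_le_of_isSuccLimit hνl)
    have hωlim := Ordinal.isSuccLimit_omega0
    refine ⟨δ + π * ω, π * ω, ν, mul_pos hπ hω, hνl, ?_, ?_⟩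
    · rw [add_assoc]
      conv_rhs => rw [show π * ω + π * ω * ν = π * ω * (1 + ν) by rw [mul_add, mul_one]]
      rw [h1ν, hβ, hν, mul_assoc]
    · intro γ hγ ξ hξ
      have hγ1 : 1 + γ < ν := by rw [← h1ν]; simpa using hγ
      have h1 : 1 < ν := lt_of_le_of_lt le_self_add hγ1
      have e : δ + π * ω + π * ω * γ = δ + π * (ω * (1 + γ)) := by
        simp only [mul_add, mul_one, add_assoc, mul_assoc]
      have l1 : ω * (1 + γ) < lam := by rw [hν]; exact mul_lt_mul_of_pos_left hγ1 hω
      have l2 : ω < lam := by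
        rw [hν]; simpa using mul_lt_mul_of_pos_left h1 hω
      rw [e]
      rcases eq_or_ne ξ 0 with rfl | hξ0
      · rw [add_zero, add_zero, d0_limit X δ π lam hπ h _ hωlim l2.le,
          d0_limit X δ π lam hπ h _ ?_ l1.le]
        rw [Ordinal.isSuccLimit_iff_omega0_dvd]
        refine ⟨(mul_pos hω (lt_of_lt_of_le one_pos le_self_add)).ne', dvd_mul_right _ _⟩
      · apply d0_shift _ _ _ _ (pos_iff_ne_zero.2 hξ0)
        intro η hη
        rw [P _ l1 _ (hη.trans hξ), P _ l2 _ (hη.trans hξ)]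

/-- `H₀(Ω)` is closed under the topological derivative operation `d₀`. -/
theorem H0_closed_d0 (Ω : Ordinal) (X : Set Ordinal) (hX : X ∈ H0 Ω) :
    d0 X ∩ Set.Iio Ω ∈ H0 Ω := by
  refine ⟨inter_subset_right, fun β hβ hl => ?_⟩
  have h := UP_d0 X β (hX.2 β hβ hl)
  rwa [inter_assoc, inter_eq_right.2 (Iio_subset_Iio hβ)]
end

section
/- Let Ω be an ordinal and A a nonempty set of ordinals. Then d₀({α < Ω : ℓ(α) ∈ A}) ∩ Ω = {α < Ω : ℓ(α) > min A}. -/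
open Ordinal Set Filter

theorem ell_zero_aux : ell 0 = 0 := by simp [ell]

theorem opow_dvd_iff_le_ell (α : Ordinal) : α ≠ 0 → ∀ e : Ordinal, (ω ^ e ∣ α ↔ e ≤ ell α) := by
  induction α using Ordinal.CNF.rec ω with
  | H0 => intro h; exact absurd rfl h
  | H α hα ih =>
    intro _ e
    have hbig : ∀ e, log ω α < e → ∀ x : Ordinal, x ≠ 0 → x ≤ α → ¬ ω ^ e ∣ x := by
      intro e he x hx hxa hd
      have h1 := Ordinal.le_of_dvd hx hd
      have h2 : α < ω ^ e := by
        rw [Ordinal.lt_opow_iff_log_lt one_lt_omega0 hα]; exact he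
      exact absurd (h1.trans hxa) (not_le.2 h2)
    have hdm := Ordinal.div_add_mod α (ω ^ log ω α)
    by_cases hr : α % ω ^ log ω α = 0
    · have hell : ell α = log ω α := by
        simp [ell, Ordinal.CNF.ne_zero hα, hr]
      rw [hell]
      constructor
      · intro h
        by_contra hlt
        exact hbig e (not_le.1 hlt) α hα le_rfl h
      · intro h
        exact (Ordinal.opow_dvd_opow ω h).trans (Ordinal.dvd_of_mod_eq_zero hr)
    · have hell : ell α = ell (α % ω ^ log ω α) := by
        unfold ell
        rw [Ordinal.CNF.ne_zero hα, Ordinal.CNF.ne_zero hr]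
        simp [List.getLast?_cons_cons]
      rw [hell, ← ih hr e]
      rcases le_or_gt e (log ω α) with h | h
      · have hd : ω ^ e ∣ ω ^ log ω α * (α / ω ^ log ω α) :=
          (Ordinal.opow_dvd_opow ω h).trans (dvd_mul_right _ _)
        conv_lhs => rw [← hdm]
        exact Ordinal.dvd_add_iff hd
      · exact iff_of_false (hbig e h α hα le_rfl) (hbig e h _ hr (Ordinal.mod_le _ _))

theorem not_omega_dvd_add_one (q : Ordinal) : ¬ ω ∣ q + 1 := by
  intro h
  have h1 : ω ∣ Order.succ q := by rwa [← Ordinal.add_one_eq_succ] 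
  have := (Ordinal.isSuccLimit_iff_omega0_dvd (a := Order.succ q)).2 ⟨by simp, h1⟩
  exact Order.not_isSuccLimit_succ _ this

/-- For nonempty `A`, `d₀({α < Ω : ℓ(α) ∈ A}) ∩ Ω = {α < Ω : ℓ(α) > min A}`. -/
theorem d0_ell_preimage (Ω : Ordinal) (A : Set Ordinal) (hA : A.Nonempty) :
    d0 {α : Ordinal | α < Ω ∧ ell α ∈ A} ∩ Set.Iio Ω
      = {α : Ordinal | α < Ω ∧ sInf A < ell α} := by
  have hm : sInf A ∈ A := csInf_mem hA
  have hmle : ∀ x ∈ A, sInf A ≤ x := fun x hx => csInf_le' hx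
  generalize sInf A = m at hm hmle
  ext α
  have hacc : α ∈ d0 {α : Ordinal | α < Ω ∧ ell α ∈ A} ↔
    Ordinal.IsAcc α {α : Ordinal | α < Ω ∧ ell α ∈ A} := Iff.rfl
  rw [mem_inter_iff, hacc, Ordinal.isAcc_iff]
  simp only [mem_Iio, mem_setOf_eq]
  have hpos : ∀ e : Ordinal, (0 : Ordinal) < ω ^ e := fun e => Ordinal.opow_pos e omega0_pos
  constructor
  · rintro ⟨⟨hα, h⟩, hΩ⟩
    refine ⟨hΩ, ?_⟩
    by_contra hle
    rw [not_lt] at hle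
    obtain ⟨c, hc⟩ := (opow_dvd_iff_le_ell α hα (ell α)).2 le_rfl
    generalize he : ell α = e at hc hle
    have hnd : ¬ ω ^ (Order.succ e) ∣ α := by
      rw [opow_dvd_iff_le_ell α hα, he]; simp
    have hcd : ¬ ω ∣ c := by
      intro hd
      apply hnd
      rw [Ordinal.opow_succ, hc]
      exact mul_dvd_mul_left _ hd
    have hc0 : c ≠ 0 := by rintro rfl; simp at hcd
    obtain ⟨d, rfl⟩ : ∃ d, c = Order.succ d := by
      rcases Ordinal.zero_or_succ_or_isSuccLimit c with h | ⟨d, h⟩ | h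
      · exact absurd h hc0
      · exact ⟨d, h.symm⟩
      · exact absurd ((Ordinal.isSuccLimit_iff_omega0_dvd.1 h).2) hcd
    have hlt : ω ^ e * d < α := by
      rw [hc]; exact (mul_lt_mul_iff_right₀ (hpos e)).2 (Order.lt_succ d)
    obtain ⟨β, ⟨_, hβA⟩, hβ1, hβ2⟩ := h _ hlt
    have hβ0 : β ≠ 0 := (bot_le.trans_lt hβ1).ne'
    obtain ⟨x, rfl⟩ := (opow_dvd_iff_le_ell β hβ0 e).2 (hle.trans (hmle _ hβA))
    rw [hc] at hβ2
    have h1 := (mul_lt_mul_iff_right₀ (hpos e)).1 hβ1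
    have h2 := (mul_lt_mul_iff_right₀ (hpos e)).1 hβ2
    exact absurd (Order.lt_succ_iff.1 h2) (not_le.2 h1)
  · rintro ⟨hΩ, hlt⟩
    have hα : α ≠ 0 := by
      rintro rfl
      rw [ell_zero_aux] at hlt
      exact absurd hlt (not_lt.2 bot_le)
    refine ⟨⟨hα, fun p hp => ?_⟩, hΩ⟩
    obtain ⟨c, hc⟩ := (opow_dvd_iff_le_ell α hα (Order.succ m)).2 (Order.succ_le_of_lt hlt)
    rw [Ordinal.opow_succ, mul_assoc] at hc
    have hne := not_omega_dvd_add_one (p / ω ^ m)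
    set q := p / ω ^ m with hq
    have hp1 : p < ω ^ m * (q + 1) := by
      have := Ordinal.lt_mul_succ_div p (hpos m).ne'
      rwa [← Ordinal.add_one_eq_succ] at this
    have hqc : q < ω * c := by
      rw [hq, Ordinal.div_lt (hpos m).ne', ← hc]; exact hp
    have hqc' : q + 1 < ω * c := by
      refine lt_of_le_of_ne (Order.add_one_le_of_lt hqc) ?_
      intro h; exact hne (h ▸ dvd_mul_right _ _)
    have hβα : ω ^ m * (q + 1) < α := by
      rw [hc]; exact (mul_lt_mul_iff_right₀ (hpos m)).2 hqc'
    have hβ0 : ω ^ m * (q + 1) ≠ 0 := (bot_le.trans_lt hp1).ne'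
    refine ⟨ω ^ m * (q + 1), ⟨hβα.trans hΩ, ?_⟩, hp1, hβα⟩
    have h1 := (opow_dvd_iff_le_ell _ hβ0 m).1 (dvd_mul_right _ _)
    have h2 : ¬ Order.succ m ≤ ell (ω ^ m * (q + 1)) := by
      rw [← opow_dvd_iff_le_ell _ hβ0, Ordinal.opow_succ]
      rintro ⟨y, hy⟩
      rw [mul_assoc] at hy
      exact hne ⟨y, mul_left_cancel₀ (hpos m).ne' hy⟩
    rw [Order.succ_le_iff, not_lt] at h2
    rwa [le_antisymm h2 h1]
end

section
/- For every ordinal β and every limit ordinal λ, the set {α < λ : ℓ(α) > β} is hereditarily periodic in λ, i.e., it belongs to H₀(λ). -/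
open Ordinal Set Filter

theorem lt_ell_iff (β α : Ordinal) : β < ell α ↔ α ≠ 0 ∧ ω ^ (β + 1) ∣ α := by
  induction α using WellFoundedLT.induction with
  | ind α ih =>
  by_cases h0 : α = 0
  · subst h0
    simp [ell]
  have hlt := lt_opow_succ_log_self one_lt_omega0 α
  have hm := mod_opow_log_lt_self ω h0
  have hda := div_add_mod α (ω ^ log ω α)
  have hno : log ω α ≤ β → ¬ ω ^ (β + 1) ∣ α := by
    intro hL hd
    have h1 := le_of_dvd h0 hd
    have h2 : (ω : Ordinal) ^ Order.succ (log ω α) ≤ ω ^ (β + 1) :=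
      opow_le_opow_right omega0_pos (by rw [← Order.succ_eq_add_one]; exact Order.succ_le_succ hL)
    exact absurd (hlt.trans_le (h2.trans h1)) (lt_irrefl _)
  by_cases hr : α % ω ^ log ω α = 0
  · have he : ell α = log ω α := by
      unfold ell
      rw [CNF.ne_zero h0, hr]
      simp
    rw [he]
    constructor
    · intro h
      refine ⟨h0, ?_⟩
      rw [hr, add_zero] at hda
      rw [← hda]
      exact Dvd.dvd.mul_right (opow_dvd_opow _ (Order.add_one_le_of_lt h)) _
    · rintro ⟨-, h⟩
      by_contra hc
      exact hno (not_lt.1 hc) h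
  · have he : ell α = ell (α % ω ^ log ω α) := by
      unfold ell
      rw [CNF.ne_zero h0]
      rw [CNF.ne_zero hr, List.getLast?_cons_cons]
    rw [he, ih _ hm]
    simp only [ne_eq, hr, h0, not_false_eq_true, true_and]
    rcases le_or_gt (log ω α) β with hL | hL
    · refine iff_of_false (fun hd => ?_) (hno hL)
      have h1 := le_of_dvd hr hd
      have h2 : (ω : Ordinal) ^ Order.succ (log ω α) ≤ ω ^ (β + 1) :=
        opow_le_opow_right omega0_pos (by rw [← Order.succ_eq_add_one]; exact Order.succ_le_succ hL)
      exact absurd (hlt.trans_le (h2.trans (h1.trans hm.le))) (lt_irrefl _)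
    · have hd : ω ^ (β + 1) ∣ ω ^ log ω α * (α / ω ^ log ω α) :=
        Dvd.dvd.mul_right (opow_dvd_opow _ (Order.add_one_le_of_lt hL)) _
      rw [← dvd_add_iff hd, hda]

theorem up_tail (X : Set Ordinal) (P t r : Ordinal) (hX : ∀ α ∈ X, P ∣ α)
    (hr : Order.IsSuccLimit r) (hrP : r ≤ P) : UP X (P * t + r) := by
  have h1r : 1 + r = r := one_add_of_omega0_le (omega0_le_of_isSuccLimit hr)
  have hn : ∀ γ < r, P * t + 1 + γ ∉ X := by
    intro γ hγ hm
    have hd := hX _ hm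
    rw [add_assoc, dvd_add_iff (dvd_mul_right P t)] at hd
    have h2 : 1 + γ < P := by
      refine lt_of_lt_of_le ?_ hrP
      rw [← h1r]
      exact add_lt_add_right hγ 1
    have h3 : (1 : Ordinal) + γ ≠ 0 := by simp
    exact absurd (le_of_dvd h3 hd) (not_le.2 h2)
  refine ⟨P * t + 1, 1, r, ?_, zero_lt_one, hr, ?_, ?_⟩
  · exact add_lt_add_right (one_lt_of_isSuccLimit hr) _
  · rw [one_mul, add_assoc, h1r]
  · intro γ hγ ξ hξ
    rw [Ordinal.lt_one_iff_zero] at hξ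
    subst hξ
    have ha := hn γ hγ
    have hb := hn 0 hr.bot_lt
    rw [one_mul, add_zero]
    exact iff_of_false ha hb

/-- For every ordinal `β` and limit ordinal `λ`, the set `{α < λ : ℓ(α) > β}`
is hereditarily periodic in `λ`. -/
theorem U1_hereditarily_periodic (β lam : Ordinal) (hlam : Order.IsSuccLimit lam) :
    {α : Ordinal | α < lam ∧ β < ell α} ∈ H0 lam := by
  refine ⟨fun α h => h.1, ?_⟩
  intro Ω hΩ hlim
  have hPl : Order.IsSuccLimit ((ω : Ordinal) ^ (β + 1)) :=
    isSuccLimit_opow_left isSuccLimit_omega0 (by simp)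
  have key := lt_ell_iff β
  generalize hP : (ω : Ordinal) ^ (β + 1) = P at hPl key
  have hP0 : 0 < P := hPl.bot_lt
  have hX : ∀ α ∈ {α : Ordinal | α < lam ∧ β < ell α} ∩ Iio Ω, P ∣ α :=
    fun α h => ((key α).1 h.1.2).2
  have hda := div_add_mod Ω P
  by_cases hr : Ω % P = 0
  · rw [hr, add_zero] at hda
    rcases zero_or_succ_or_isSuccLimit (Ω / P) with hq | ⟨t, ht⟩ | hq
    · rw [hq, mul_zero] at hda
      exact absurd hda.symm hlim.bot_lt.ne'
    · have := up_tail _ P t P hX hPl le_rfl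
      rw [← ht, mul_succ] at hda
      rwa [hda] at this
    · generalize Ω / P = q at hda hq
      have h1q : 1 + q = q := one_add_of_omega0_le (omega0_le_of_isSuccLimit hq)
      have hlt : ∀ γ < q, ∀ ξ < P, P + P * γ + ξ < Ω := by
        intro γ hγ ξ hξ
        have h1 : P + P * γ + ξ < P + P * γ + P := add_lt_add_right hξ _
        refine h1.trans_le ?_
        rw [add_assoc, ← mul_succ, ← hda]
        conv_rhs => rw [← h1q, mul_add, mul_one]
        exact add_le_add_right (mul_le_mul_right (Order.succ_le_of_lt hγ) P) P
      have hmem : ∀ γ < q, ∀ ξ < P,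
          (P + P * γ + ξ ∈ {α : Ordinal | α < lam ∧ β < ell α} ∩ Iio Ω ↔ P ∣ ξ) := by
        intro γ hγ ξ hξ
        have h := hlt γ hγ ξ hξ
        have hne : P + P * γ + ξ ≠ 0 := by
          simp [hP0.ne']
        have hd : P ∣ P + P * γ := (dvd_add_iff dvd_rfl).2 (dvd_mul_right _ _)
        constructor
        · intro hm
          exact (dvd_add_iff hd).1 (hX _ hm)
        · intro hx
          exact ⟨⟨h.trans_le hΩ, (key _).2 ⟨hne, (dvd_add_iff hd).2 hx⟩⟩, h⟩
      refine ⟨P, P, q, ?_, hP0, hq, ?_, ?_⟩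
      · simpa using hlt 0 hq.bot_lt 0 hP0
      · rw [← hda]
        conv_lhs => rw [← h1q, mul_add, mul_one]
      · intro γ hγ ξ hξ
        have h2 := hmem 0 hq.bot_lt ξ hξ
        rw [mul_zero, add_zero] at h2
        rw [hmem γ hγ ξ hξ, h2]
  · have hrl : Order.IsSuccLimit (Ω % P) := by
      have h := hlim
      rw [← hda, isSuccLimit_add_iff] at h
      rcases h with h | h
      · exact h
      · exact absurd h.1 hr
    have := up_tail _ P (Ω / P) (Ω % P) hX hrl (mod_lt Ω hP0.ne').le
    rwa [hda] at this
end

section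
/- Suppose X is ultimately periodic in a limit ordinal Ω and A is any set of ordinals. Then d₀(X ∩ {α : ℓ(α) ∈ A}) ∩ Ω is ultimately periodic in Ω. -/
open Ordinal Set Filter

theorem aux_not_omega_dvd (c : Ordinal) : ¬ ω ∣ c + 1 := by
  intro h
  have := isSuccPrelimit_iff_omega0_dvd.2 h
  rw [← Order.succ_eq_add_one] at this
  exact Order.not_isSuccPrelimit_succ c this

theorem aux_le {e f c d : Ordinal} (h : ω ^ e * (c + 1) = ω ^ f * (d + 1)) : f ≤ e := by
  by_contra hlt
  push Not at hlt
  have h1 : ω ^ (e + 1) ∣ ω ^ e * (c + 1) := by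
    rw [h]
    exact (opow_dvd_opow ω (Order.succ_le_of_lt hlt)).mul_right _
  obtain ⟨k, hk⟩ := h1
  rw [opow_add, opow_one, mul_assoc] at hk
  have h2 := mul_left_cancel₀ (opow_pos e omega0_pos).ne' hk
  exact aux_not_omega_dvd c ⟨k, h2⟩

theorem ell_spec (α : Ordinal) (hα : α ≠ 0) : ∃ c, α = ω ^ ell α * (c + 1) := by
  induction α using WellFoundedLT.induction with
  | ind α ih =>
  have hC := CNF.ne_zero (b := ω) hα
  set L := log ω α with hL
  have hdm := div_add_mod α (ω ^ L)
  have hpos : ω ^ L ≠ 0 := (opow_pos L omega0_pos).ne'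
  by_cases hr : α % ω ^ L = 0
  · have hell : ell α = L := by
      unfold ell
      rw [hC, hr]
      simp
    have h1 := div_opow_log_pos ω hα
    have h2 := div_opow_log_lt α one_lt_omega0
    obtain ⟨n, hn⟩ := lt_omega0.1 h2
    rw [← hL] at hn h1
    rw [hn] at h1
    obtain ⟨m, rfl⟩ : ∃ m, n = m + 1 := Nat.exists_eq_succ_of_ne_zero (by rintro rfl; simp at h1)
    refine ⟨m, ?_⟩
    rw [hell]
    rw [hr, hn, add_zero] at hdm
    rw [← hdm]
    push_cast
    rfl
  · have hlt : α % ω ^ L < α := mod_opow_log_lt_self ω hα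
    obtain ⟨c, hc⟩ := ih _ hlt hr
    have hell : ell α = ell (α % ω ^ L) := by
      conv_lhs => unfold ell
      conv_rhs => unfold ell
      rw [hC, CNF.ne_zero hr]
      simp [List.getLast?_cons_cons]
    rw [← hell] at hc
    have hle : ell α ≤ L := by
      have h1 : ω ^ ell α ≤ α % ω ^ L := by
        rw [hc]
        exact le_mul_left _ (by simp)
      have h2 := h1.trans_lt (mod_lt α hpos)
      exact ((opow_lt_opow_iff_right one_lt_omega0).1 h2).le
    obtain ⟨k, hk⟩ := opow_dvd_opow ω hle
    refine ⟨k * (α / ω ^ L) + c, ?_⟩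
    conv_lhs => rw [← hdm, hc]
    rw [hk, mul_assoc, ← mul_add, ← add_assoc, ← hk]

theorem ell_eq {α e c : Ordinal} (h : α = ω ^ e * (c + 1)) : ell α = e := by
  have hα : α ≠ 0 := by
    rw [h]
    exact (mul_pos (opow_pos e omega0_pos) (by simp)).ne'
  obtain ⟨d, hd⟩ := ell_spec α hα
  exact le_antisymm (aux_le (h.symm.trans hd)) (aux_le (hd.symm.trans h))

theorem ell_add (β ξ : Ordinal) (hξ : ξ ≠ 0) : ell (β + ξ) = ell ξ := by
  obtain ⟨c, hc⟩ := ell_spec ξ hξ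
  set e := ell ξ
  have hpos : ω ^ e ≠ 0 := (opow_pos e omega0_pos).ne'
  apply ell_eq (c := β / ω ^ e + c)
  rw [add_assoc, mul_add, ← hc]
  conv_lhs => rw [← div_add_mod β (ω ^ e), add_assoc]
  congr 1
  have h0 : ω ^ e ≤ ξ := by
    rw [hc]
    exact le_mul_left _ (by simp)
  rw [← Ordinal.add_sub_cancel_of_le h0, ← add_assoc, add_omega0_opow (mod_lt _ hpos)]

theorem ell_mul (π e c : Ordinal) (hπ : 0 < π) :
    ell (π * (ω ^ e * (c + 1))) = ell (π * ω ^ e) := by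
  rw [← mul_assoc, mul_add, mul_one]
  exact ell_add _ _ (mul_pos hπ (opow_pos e omega0_pos)).ne'

theorem up_of (Y : Set Ordinal) (Ω δ π lam ρ : Ordinal) (hπ : 0 < π)
    (hlam : Order.IsSuccLimit lam) (hΩ : Ω = δ + π * lam) (hρ : ρ = 1 ∨ Order.IsSuccLimit ρ)
    (Q : Prop → Ordinal → Prop)
    (h : ∀ γ, 0 < γ → γ < lam → ∀ ξ < π, (δ + π * γ + ξ ∈ Y ↔ Q (ρ ∣ γ) ξ)) : UP Y Ω := by
  have hρ0 : 0 < ρ := by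
    rcases hρ with rfl | hρ
    · simp
    · exact (zero_lt_one).trans (one_lt_of_isSuccLimit hρ)
  have hlam0 : lam ≠ 0 := by rintro rfl; exact not_isSuccLimit_zero hlam
  by_cases hq : ∃ q, Order.IsSuccLimit q ∧ lam = ρ * q
  · obtain ⟨q, hq, rfl⟩ := hq
    have h1q : 1 + q = q := one_add_of_omega0_le (omega0_le_of_isSuccLimit hq)
    refine ⟨δ + π * ρ, π * ρ, q, ?_, mul_pos hπ hρ0, hq, ?_, ?_⟩
    · rw [hΩ]
      have : ρ * 1 < ρ * q := mul_lt_mul_of_pos_left (one_lt_of_isSuccLimit hq) hρ0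
      rw [mul_one] at this
      have := mul_lt_mul_of_pos_left this hπ
      gcongr
    · rw [hΩ, add_assoc]
      congr 1
      conv_lhs => rw [← h1q]
      rw [mul_add, mul_one, mul_add, mul_assoc]
    · have key : ∀ γ < q, ∀ ξ < π * ρ,
          (δ + π * ρ + π * ρ * γ + ξ ∈ Y ↔ Q (ρ ∣ ξ / π) (ξ % π)) := by
        intro γ hγ ξ hξ
        have hη : ξ / π < ρ := (lt_mul_iff_div_lt hπ.ne').1 hξ
        have e1 : δ + π * ρ + π * ρ * γ + ξ = δ + π * (ρ * (1 + γ) + ξ / π) + ξ % π := by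
          conv_lhs => rw [← div_add_mod ξ π]
          simp only [mul_add, mul_one, add_assoc, mul_assoc]
        rw [e1, h _ _ _ _ (mod_lt _ hπ.ne'), dvd_add_iff (dvd_mul_right _ _)]
        · exact lt_of_lt_of_le (mul_pos hρ0 (lt_of_lt_of_le zero_lt_one le_self_add)) le_self_add
        · have h2 : 1 + γ < q := by
            rw [← h1q]; gcongr
          have h3 : 1 + γ + 1 ≤ q := by
            rw [← Order.succ_eq_add_one]; exact Order.succ_le_of_lt h2
          calc ρ * (1 + γ) + ξ / π < ρ * (1 + γ) + ρ := by gcongr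
            _ = ρ * (1 + γ + 1) := by rw [mul_add _ _ 1, mul_one]
            _ ≤ ρ * q := by gcongr
      intro γ hγ ξ hξ
      have k0 := key 0 (zero_lt_one.trans (one_lt_of_isSuccLimit hq)) ξ hξ
      rw [mul_zero, add_zero] at k0
      rw [key γ hγ ξ hξ, k0]
  · have hex : ∃ q r, lam = ρ * q + r ∧ r ≠ 0 ∧ r ≤ ρ := by
      by_cases hm : lam % ρ = 0
      · have hd := div_add_mod lam ρ
        rw [hm, add_zero] at hd
        rcases zero_or_succ_or_isSuccLimit (lam / ρ) with h0 | ⟨q', h0⟩ | h0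
        · rw [h0, mul_zero] at hd
          exact absurd hd.symm hlam0
        · refine ⟨q', ρ, ?_, hρ0.ne', le_rfl⟩
          rw [← hd, ← h0, Order.succ_eq_add_one, mul_add, mul_one]
        · exact absurd ⟨_, h0, hd.symm⟩ hq
      · exact ⟨lam / ρ, lam % ρ, (div_add_mod _ _).symm, hm, (mod_lt _ hρ0.ne').le⟩
    obtain ⟨q, r, rfl, hr0, hrρ⟩ := hex
    have hr : Order.IsSuccLimit r := by
      rcases isSuccLimit_add_iff.1 hlam with h1 | h1
      · exact h1
      · exact absurd h1.1 hr0
    have h1r : 1 + r = r := one_add_of_omega0_le (omega0_le_of_isSuccLimit hr)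
    refine ⟨δ + π * (ρ * q + 1), π, r, ?_, hπ, hr, ?_, ?_⟩
    · rw [hΩ]
      have h1 := one_lt_of_isSuccLimit hr
      have : π * (ρ * q + 1) < π * (ρ * q + r) := mul_lt_mul_of_pos_left (by gcongr) hπ
      gcongr
    · rw [hΩ, add_assoc, ← mul_add, add_assoc, h1r]
    · have key : ∀ γ < r, ∀ ξ < π,
          (δ + π * (ρ * q + 1) + π * γ + ξ ∈ Y ↔ Q False ξ) := by
        intro γ hγ ξ hξ
        have h2 : 1 + γ < r := by
            rw [← h1r]; gcongr
        have e1 : δ + π * (ρ * q + 1) + π * γ + ξ = δ + π * (ρ * q + (1 + γ)) + ξ := by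
          simp only [mul_add, mul_one, add_assoc]
        have hnd : ¬ ρ ∣ ρ * q + (1 + γ) := by
          rw [dvd_add_iff (dvd_mul_right _ _)]
          intro hd
          have := le_of_dvd (by simp) hd
          exact absurd (this.trans_lt h2) (not_lt.2 hrρ)
        rw [e1, h _ _ _ _ hξ]
        · simp [hnd]
        · exact lt_of_lt_of_le (lt_of_lt_of_le zero_lt_one (le_self_add (b := γ))) le_add_self
        · gcongr
      intro γ hγ ξ hξ
      have k0 := key 0 (zero_lt_one.trans (one_lt_of_isSuccLimit hr)) ξ hξ
      rw [mul_zero, add_zero] at k0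
      rw [key γ hγ ξ hξ, k0]

theorem mem_d0 (S : Set Ordinal) (x : Ordinal) :
    x ∈ d0 S ↔ x ≠ 0 ∧ ∀ p < x, ∃ s ∈ S, p < s ∧ s < x := by
  have : x ∈ d0 S ↔ AccPt x (𝓟 S) := Iff.rfl
  rw [this, SuccOrder.accPt_principal]
  simp only [isMin_iff_eq_bot, Set.Nonempty, Set.mem_inter_iff, Set.mem_Ioo]
  rfl

theorem mem_d0_add (S : Set Ordinal) (a ξ : Ordinal) (hξ : 0 < ξ) :
    a + ξ ∈ d0 S ↔ ∀ η < ξ, ∃ ζ, η < ζ ∧ ζ < ξ ∧ a + ζ ∈ S := by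
  rw [mem_d0]
  constructor
  · rintro ⟨-, h⟩ η hη
    obtain ⟨s, hs, h1, h2⟩ := h (a + η) (by gcongr)
    obtain ⟨ζ, rfl⟩ := exists_add_of_le (le_self_add.trans h1.le)
    exact ⟨ζ, by simpa using h1, by simpa using h2, hs⟩
  · intro h
    refine ⟨(lt_of_lt_of_le hξ le_add_self).ne', fun p hp => ?_⟩
    rcases lt_or_ge p a with hpa | hpa
    · obtain ⟨ζ, h1, h2, h3⟩ := h 0 hξ
      exact ⟨_, h3, hpa.trans_le le_self_add, by gcongr⟩
    · obtain ⟨η, rfl⟩ := exists_add_of_le hpa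
      obtain ⟨ζ, h1, h2, h3⟩ := h η (by simpa using hp)
      exact ⟨_, h3, by gcongr, by gcongr⟩

theorem up_main (Ω δ π lam : Ordinal) (X A : Set Ordinal) (hX : UPWith X Ω δ π lam) :
    UP (d0 (X ∩ {α : Ordinal | ell α ∈ A}) ∩ Set.Iio Ω) Ω := by
  obtain ⟨hδ, hπ, hlam, hΩ, hper⟩ := hX
  set S := X ∩ {α : Ordinal | ell α ∈ A} with hS
  have hlam0 : 0 < lam := zero_lt_one.trans (one_lt_of_isSuccLimit hlam)
  have hlt : ∀ γ < lam, ∀ ξ < π, δ + π * γ + ξ < Ω := by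
    intro γ hγ ξ hξ
    have h3 : γ + 1 ≤ lam := by
      rw [← Order.succ_eq_add_one]; exact Order.succ_le_of_lt hγ
    calc δ + π * γ + ξ < δ + π * γ + π := by gcongr
      _ = δ + π * (γ + 1) := by rw [mul_add, mul_one, add_assoc]
      _ ≤ Ω := by rw [hΩ]; gcongr
  -- periodicity of `S` away from the multiples of `π`
  have hSper : ∀ γ < lam, ∀ ξ < π, 0 < ξ → (δ + π * γ + ξ ∈ S ↔ δ + ξ ∈ S) := by
    intro γ hγ ξ hξ h0
    simp only [hS, Set.mem_inter_iff, Set.mem_ofPred_eq, ell_add _ ξ h0.ne', hper γ hγ ξ hξ]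
  have hdper : ∀ γ < lam, ∀ ξ ≤ π, 0 < ξ → (δ + π * γ + ξ ∈ d0 S ↔ δ + ξ ∈ d0 S) := by
    intro γ hγ ξ hξ h0
    rw [mem_d0_add _ _ _ h0, mem_d0_add _ _ _ h0]
    refine forall₂_congr fun η hη => exists_congr fun ζ => and_congr_right fun h1 =>
      and_congr_right fun h2 => ?_
    exact hSper γ hγ ζ (h2.trans_le hξ) (lt_of_le_of_lt zero_le h1)
  by_cases hc : ∃ ξ, 0 < ξ ∧ ξ < π ∧ δ + ξ ∈ S
  · obtain ⟨ξ₀, h0, hξ₀, hmem⟩ := hc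
    refine up_of _ Ω δ π lam ω hπ hlam hΩ (Or.inr isSuccLimit_omega0)
      (fun b ξ => if ξ = 0 then (b ∨ δ + π ∈ d0 S) else δ + ξ ∈ d0 S) ?_
    intro γ hγ0 hγ ξ hξ
    simp only [Set.mem_inter_iff, Set.mem_Iio, hlt γ hγ ξ hξ, and_true]
    split_ifs with hz
    · subst hz
      rw [add_zero]
      rcases zero_or_succ_or_isSuccLimit γ with h1 | ⟨γ', h1⟩ | h1
      · exact absurd h1 hγ0.ne'
      · have hnd : ¬ ω ∣ γ := by
          rw [← h1, Order.succ_eq_add_one]; exact aux_not_omega_dvd γ'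
        have hγ' : γ' < lam := lt_of_lt_of_le (by rw [← h1]; exact Order.lt_succ γ') hγ.le
        rw [← h1, Order.succ_eq_add_one] at hnd ⊢
        simp only [hnd, false_or]
        rw [mul_add, mul_one, ← add_assoc]
        exact hdper γ' hγ' π le_rfl hπ
      · have hd : ω ∣ γ := isSuccPrelimit_iff_omega0_dvd.1 h1.isSuccPrelimit
        simp only [hd, true_or, iff_true]
        rw [mem_d0_add _ _ _ (mul_pos hπ hγ0)]
        intro η hη
        have hq : η / π < γ := (lt_mul_iff_div_lt hπ.ne').1 hη
        have hq1 : η / π + 1 < γ := by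
          rw [← Order.succ_eq_add_one]; exact h1.succ_lt hq
        refine ⟨π * (η / π + 1) + ξ₀, ?_, ?_, ?_⟩
        · refine lt_of_lt_of_le (lt_mul_div_add η hπ.ne') ?_
          rw [mul_add, mul_one]
          exact le_self_add
        · have hq2 : η / π + 1 + 1 ≤ γ := by
            rw [← Order.succ_eq_add_one (η / π + 1)]; exact Order.succ_le_of_lt hq1
          calc π * (η / π + 1) + ξ₀ < π * (η / π + 1) + π := by gcongr
            _ = π * (η / π + 1 + 1) := by rw [mul_add _ (η / π + 1) 1, mul_one]
            _ ≤ π * γ := by gcongr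
        · rw [← add_assoc]
          exact (hSper _ (hq1.trans hγ) ξ₀ hξ₀ h0).2 hmem
    · exact hdper γ hγ ξ hξ.le (pos_iff_ne_zero.2 hz)
  · push Not at hc
    -- all elements of `S` between `δ` and `Ω` are multiples of `π`
    have hform : ∀ ζ, 0 < ζ → ζ < π * lam → δ + ζ ∈ S →
        ∃ γ, 0 < γ ∧ γ < lam ∧ ζ = π * γ := by
      intro ζ h1 h2 h3
      have hq : ζ / π < lam := (lt_mul_iff_div_lt hπ.ne').1 h2
      have hm := mod_lt ζ hπ.ne'
      have hd := div_add_mod ζ π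
      have hz : ζ % π = 0 := by
        by_contra hne
        have hp := pos_iff_ne_zero.2 hne
        rw [← hd, ← add_assoc, hSper _ hq _ hm hp] at h3
        exact hc _ hp hm h3
      rw [hz, add_zero] at hd
      refine ⟨ζ / π, ?_, hq, hd.symm⟩
      rw [pos_iff_ne_zero]
      intro h0
      rw [h0, mul_zero] at hd
      exact h1.ne hd
    have hSmul : ∀ γ, 0 < γ → γ < lam →
        (δ + π * γ ∈ S ↔ δ ∈ X ∧ ell (π * ω ^ ell γ) ∈ A) := by
      intro γ h0 hγ
      obtain ⟨c, hcc⟩ := ell_spec γ h0.ne'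
      have e1 : ell (δ + π * γ) = ell (π * ω ^ ell γ) := by
        rw [ell_add _ _ (mul_pos hπ h0).ne']
        conv_lhs => rw [hcc]
        exact ell_mul _ _ _ hπ
      have := hper γ hγ 0 hπ
      rw [add_zero, add_zero] at this
      simp only [hS, Set.mem_inter_iff, Set.mem_ofPred_eq, e1, this]
    have hzero : ∀ γ < lam, ∀ ξ < π, 0 < ξ → ¬ (δ + π * γ + ξ ∈ d0 S) := by
      intro γ hγ ξ hξ h0 hmem
      rw [hdper γ hγ ξ hξ.le h0, mem_d0_add _ _ _ h0] at hmem
      obtain ⟨ζ, h1, h2, h3⟩ := hmem 0 h0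
      exact hc ζ h1 (h2.trans hξ) h3
    by_cases hB : δ ∈ X ∧ ∃ e : Ordinal, ell (π * ω ^ e) ∈ A
    · obtain ⟨hδX, hB⟩ := hB
      obtain ⟨m, hm, hmin⟩ : ∃ m : Ordinal, ell (π * ω ^ m) ∈ A ∧ ∀ e : Ordinal, ell (π * ω ^ e) ∈ A → m ≤ e :=
        ⟨sInf {e : Ordinal | ell (π * ω ^ e) ∈ A}, csInf_mem (s := {e : Ordinal | ell (π * ω ^ e) ∈ A}) hB,
          fun e he => csInf_le' he⟩
      have hmpos : 0 < ω ^ m := opow_pos m omega0_pos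
      refine up_of _ Ω δ π lam (ω ^ m * ω) hπ hlam hΩ
        (Or.inr (isSuccLimit_mul_right hmpos isSuccLimit_omega0)) (fun b ξ => b ∧ ξ = 0) ?_
      intro γ hγ0 hγ ξ hξ
      simp only [Set.mem_inter_iff, Set.mem_Iio, hlt γ hγ ξ hξ, and_true]
      by_cases hz : ξ = 0
      · subst hz
        simp only [and_true, add_zero]
        rw [mem_d0_add _ _ _ (mul_pos hπ hγ0)]
        constructor
        · intro h
          -- elements below `γ`
          have h' : ∀ κ < γ, ∃ κ', κ < κ' ∧ κ' < γ ∧ ω ^ m ∣ κ' := by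
            intro κ hκ
            obtain ⟨ζ, h1, h2, h3⟩ := h (π * κ) (mul_lt_mul_of_pos_left hκ hπ)
            have h4 : ζ < π * lam := h2.trans (mul_lt_mul_of_pos_left hγ hπ)
            obtain ⟨κ', k0, k1, rfl⟩ := hform ζ (lt_of_le_of_lt zero_le h1) h4 h3
            refine ⟨κ', lt_of_mul_lt_mul_left h1 zero_le, lt_of_mul_lt_mul_left h2 zero_le, ?_⟩
            have h5 := hmin _ ((hSmul κ' k0 k1).1 h3).2
            obtain ⟨c, hcc⟩ := ell_spec κ' k0.ne'
            rw [hcc]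
            exact (opow_dvd_opow ω h5).mul_right _
          have hdm := div_add_mod γ (ω ^ m)
          have hr : γ % ω ^ m = 0 := by
            by_contra hne
            have hp := pos_iff_ne_zero.2 hne
            obtain ⟨κ', k1, k2, ⟨d, rfl⟩⟩ := h' (ω ^ m * (γ / ω ^ m)) (by
              conv_rhs => rw [← hdm]
              simpa using hp)
            have k3 := lt_of_mul_lt_mul_left k1 zero_le
            have k4 : d ≤ γ / ω ^ m := by
              rw [← mul_div_cancel d hmpos.ne']
              exact div_le_left k2.le _
            exact absurd k3 (not_lt.2 k4)
          rw [hr, add_zero] at hdm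
          rcases zero_or_succ_or_isSuccLimit (γ / ω ^ m) with h1 | ⟨q, h1⟩ | h1
          · rw [h1, mul_zero] at hdm
            exact absurd hdm hγ0.ne
          · rw [← h1] at hdm
            obtain ⟨κ', k1, k2, ⟨d, rfl⟩⟩ := h' (ω ^ m * q) (by
              rw [← hdm]
              exact mul_lt_mul_of_pos_left (Order.lt_succ q) hmpos)
            have k3 := lt_of_mul_lt_mul_left k1 zero_le
            rw [← hdm] at k2
            have k4 := lt_of_mul_lt_mul_left k2 zero_le
            exact absurd k3 (not_lt.2 (Order.lt_succ_iff.1 k4))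
          · rw [← hdm]
            exact mul_dvd_mul_left _ (isSuccPrelimit_iff_omega0_dvd.1 h1.isSuccPrelimit)
        · rintro ⟨c, rfl⟩ η hη
          rw [mul_assoc] at hη hγ ⊢
          have hc0 : c ≠ 0 := by
            rintro rfl
            simp at hγ0
          have hL : Order.IsSuccLimit (ω * c) :=
            isSuccLimit_mul_left isSuccLimit_omega0 (pos_iff_ne_zero.2 hc0)
          rw [← mul_assoc] at hη
          have hpp : 0 < π * ω ^ m := mul_pos hπ hmpos
          have hq : η / (π * ω ^ m) < ω * c := (lt_mul_iff_div_lt hpp.ne').1 hη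
          have hq1 : η / (π * ω ^ m) + 1 < ω * c := by
            rw [← Order.succ_eq_add_one]; exact hL.succ_lt hq
          set q := η / (π * ω ^ m) with hqdef
          have hlt1 : ω ^ m * (q + 1) < ω ^ m * (ω * c) := mul_lt_mul_of_pos_left hq1 hmpos
          refine ⟨π * (ω ^ m * (q + 1)), ?_, mul_lt_mul_of_pos_left hlt1 hπ, ?_⟩
          · rw [← mul_assoc, mul_add, mul_one]
            exact lt_mul_div_add η hpp.ne'
          · have hne : 0 < ω ^ m * (q + 1) :=
              mul_pos hmpos (lt_of_lt_of_le zero_lt_one le_add_self)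
            rw [hSmul _ hne (hlt1.trans hγ)]
            refine ⟨hδX, ?_⟩
            rw [ell_eq (c := q) (e := m) rfl]
            exact hm
      · simp only [hz, and_false, iff_false]
        exact hzero γ hγ ξ hξ (pos_iff_ne_zero.2 hz)
    · refine up_of _ Ω δ π lam 1 hπ hlam hΩ (Or.inl rfl) (fun _ _ => False) ?_
      intro γ hγ0 hγ ξ hξ
      simp only [Set.mem_inter_iff, Set.mem_Iio, hlt γ hγ ξ hξ, and_true, iff_false]
      by_cases hz : ξ = 0
      · subst hz
        rw [add_zero, mem_d0_add _ _ _ (mul_pos hπ hγ0)]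
        intro h
        obtain ⟨ζ, h1, h2, h3⟩ := h 0 (mul_pos hπ hγ0)
        have h4 : ζ < π * lam := h2.trans (mul_lt_mul_of_pos_left hγ hπ)
        obtain ⟨κ', k0, k1, rfl⟩ := hform ζ h1 h4 h3
        have h5 := (hSmul κ' k0 k1).1 h3
        exact hB ⟨h5.1, _, h5.2⟩
      · exact hzero γ hγ ξ hξ (pos_iff_ne_zero.2 hz)

/-- If `X` is ultimately periodic in a limit ordinal `Ω` and `A` is any set of
ordinals, then `d₀(X ∩ ℓ⁻¹(A)) ∩ Ω` is ultimately periodic in `Ω`. -/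
theorem up_d0_ell_preimage (Ω : Ordinal) (hΩ : Order.IsSuccLimit Ω) (X A : Set Ordinal)
    (hX : UP X Ω) :
    UP (d0 (X ∩ {α : Ordinal | ell α ∈ A}) ∩ Set.Iio Ω) Ω := by
  obtain ⟨δ, π, lam, h⟩ := hX
  exact up_main Ω δ π lam X A h
end

section
/- If B ∈ H₀(Ω) and A is any set of ordinals, then d₀(B ∩ {α < Ω : ℓ(α) ∈ A}) ∩ Ω ∈ H₀(Ω). -/
open Ordinal Set Filter

theorem aux_limit_opow {μ : Ordinal} (h : 0 < μ) : Order.IsSuccLimit (ω ^ μ) :=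
  isSuccLimit_opow_left isSuccLimit_omega0 h.ne'

theorem aux_add_omega (a : Ordinal) : ¬ ω ∣ a + 1 := by
  intro h
  have := isSuccLimit_iff_omega0_dvd.2 ⟨by simp, h⟩
  rw [← Order.succ_eq_add_one] at this
  exact Order.not_isSuccLimit_succ _ this

theorem aux_ell_spec (α : Ordinal) (h : α ≠ 0) : ∃ s, α = ω ^ (ell α) * (s + 1) := by
  induction α using WellFoundedLT.induction with
  | ind α ih =>
  set l := log ω α with hl
  have hpos : (ω ^ l : Ordinal) ≠ 0 := (opow_pos _ omega0_pos).ne'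
  have hcnf := CNF.ne_zero (b := ω) h
  rw [← hl] at hcnf
  have hdm := div_add_mod α (ω ^ l)
  by_cases hr : α % ω ^ l = 0
  · have he : ell α = l := by
      unfold ell
      rw [hcnf, hr]; simp
    rw [he]
    have hq : α / ω ^ l < ω := by
      exact div_opow_log_lt α one_lt_omega0
    have hq0 : α / ω ^ l ≠ 0 := by
      intro h0
      rw [h0, hr] at hdm
      simp at hdm
      exact h hdm.symm
    obtain ⟨n, hn⟩ := lt_omega0.1 hq
    rw [hn] at hq0 hdm
    obtain _ | n := n
    · simp at hq0
    · refine ⟨n, ?_⟩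
      rw [hr] at hdm
      simpa using hdm.symm
  · have hlt : α % ω ^ l < α := mod_opow_log_lt_self _ h
    have he : ell α = ell (α % ω ^ l) := by
      unfold ell
      rw [hcnf]
      have : CNF ω (α % ω ^ l) ≠ [] := by
        rw [CNF.ne_zero hr]; simp
      obtain ⟨x, t, hx⟩ := List.exists_cons_of_ne_nil this
      rw [hx, List.getLast?_cons_cons]
    obtain ⟨s, hs⟩ := ih _ hlt hr
    rw [← he] at hs
    have hle : ell α ≤ l := by
      have h1 : ω ^ ell α ≤ α % ω ^ l := by
        rw [hs]
        exact le_mul_of_one_le_right' (by simp)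
      have h2 := h1.trans_lt (mod_lt α hpos)
      exact ((opow_lt_opow_iff_right one_lt_omega0).1 h2).le
    obtain ⟨k, hk⟩ := exists_add_of_le hle
    refine ⟨ω ^ k * (α / ω ^ l) + s, ?_⟩
    conv_lhs => rw [← hdm, hs]
    nth_rewrite 1 [hk]
    rw [opow_add, mul_assoc, add_assoc]; simp only [mul_add]

theorem aux_ell_unique {α e s : Ordinal} (h : α = ω ^ e * (s + 1)) : ell α = e := by
  have h0 : α ≠ 0 := by
    rw [h]; exact mul_ne_zero (opow_pos _ omega0_pos).ne' (by simp)
  obtain ⟨s', hs'⟩ := aux_ell_spec α h0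
  have key : ∀ {a b x y : Ordinal}, a < b → ω ^ a * (x + 1) = ω ^ b * (y + 1) → False := by
    intro a b x y hab hh
    obtain ⟨k, rfl⟩ := exists_add_of_le (Order.add_one_le_of_lt hab)
    rw [opow_add, opow_add, opow_one, mul_assoc, mul_assoc] at hh
    have := mul_left_cancel₀ (opow_pos a omega0_pos).ne' hh
    exact aux_add_omega x ⟨_, this⟩
  rcases lt_trichotomy (ell α) e with h1 | h1 | h1
  · exact (key h1 (hs'.symm.trans h)).elim
  · exact h1
  · exact (key h1 (h.symm.trans hs')).elim

theorem aux_ell_add (x : Ordinal) {ξ : Ordinal} (h : 0 < ξ) : ell (x + ξ) = ell ξ := by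
  obtain ⟨s, hs⟩ := aux_ell_spec ξ h.ne'
  set e := ell ξ
  have hpos : (ω ^ e : Ordinal) ≠ 0 := (opow_pos _ omega0_pos).ne'
  have hle : ω ^ e ≤ ξ := by
    rw [hs]
    exact le_mul_of_one_le_right' (by simp)
  apply aux_ell_unique (s := x / ω ^ e + s)
  conv_lhs => rw [← div_add_mod x (ω ^ e), add_assoc, add_of_omega0_opow_le (mod_lt x hpos) hle, hs]
  rw [add_assoc]; simp only [mul_add]

theorem aux_d0_iff (S : Set Ordinal) (x : Ordinal) :
    x ∈ d0 S ↔ x ≠ 0 ∧ ∀ y < x, ∃ z ∈ S, y < z ∧ z < x := by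
  have : x ∈ d0 S ↔ AccPt x (Filter.principal S) := Iff.rfl
  rw [this, SuccOrder.accPt_principal]
  simp [Set.Nonempty, isMin_iff_eq_bot]

theorem aux_d0_add (S : Set Ordinal) (x : Ordinal) {ξ : Ordinal} (h : 0 < ξ) :
    x + ξ ∈ d0 S ↔ ∀ y < ξ, ∃ z, y < z ∧ z < ξ ∧ x + z ∈ S := by
  rw [aux_d0_iff]
  constructor
  · rintro ⟨-, H⟩ y hy
    obtain ⟨w, hw, h1, h2⟩ := H (x + y) (by simpa using hy)
    obtain ⟨z, rfl⟩ := exists_add_of_le ((le_add_of_nonneg_right zero_le).trans h1.le : x ≤ w)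
    exact ⟨z, by simpa using h1, by simpa using h2, hw⟩
  · intro H
    refine ⟨fun h0 => ?_, fun y hy => ?_⟩
    · have : ξ ≤ x + ξ := le_add_self
      rw [h0] at this
      exact absurd h (not_lt.2 this)
    · rcases lt_or_ge y x with hyx | hyx
      · obtain ⟨z, h1, h2, h3⟩ := H 0 h
        exact ⟨_, h3, hyx.trans_le le_self_add, by simpa using h2⟩
      · obtain ⟨y', rfl⟩ := exists_add_of_le hyx
        obtain ⟨z, h1, h2, h3⟩ := H y' (by simpa using hy)
        exact ⟨_, h3, by simpa using h1, by simpa using h2⟩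

theorem aux_G (G : Ordinal → Prop) (hG : ∀ x y, 0 < y → (G (x + y) ↔ G y)) :
    (∀ γ, 0 < γ → ¬ G γ) ∨ ∃ a : Ordinal, ∀ γ, 0 < γ →
      ((∀ y < γ, ∃ z, y < z ∧ z < γ ∧ G z) ↔ ω ^ a ∣ γ) := by
  by_cases hne : ∃ γ, 0 < γ ∧ G γ
  swap
  · left; intro γ h1 h2; exact hne ⟨γ, h1, h2⟩
  right
  obtain ⟨g, ⟨hg0, hgG⟩, hmin⟩ := WellFounded.has_min (wellFounded_lt (α := Ordinal))
    {γ | 0 < γ ∧ G γ} hne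
  have hmin' : ∀ x, 0 < x → x < g → ¬ G x := fun x h1 h2 h3 => hmin x ⟨h1, h3⟩ h2
  have hpr : IsPrincipal (· + ·) g := by
    rw [isPrincipal_add_iff_add_lt_ne_self]
    intro b hb c hc hbc
    have hc0 : 0 < c := by
      rw [pos_iff_ne_zero]; rintro rfl
      simp at hbc; exact hb.ne hbc
    exact hmin' c hc0 hc ((hG b c hc0).1 (hbc ▸ hgG))
  rcases isPrincipal_add_iff_zero_or_omega0_opow.1 hpr with h0 | ⟨a, ha⟩
  · exact absurd h0 hg0.ne'
  simp only at ha
  refine ⟨a + 1, fun γ hγ => ?_⟩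
  rw [opow_add, opow_one, ha]
  have noG : ∀ x y, y ≤ g → ∀ z, x < z → z < x + y → ¬ G z := by
    intro x y hy z h1 h2 h3
    obtain ⟨w, rfl⟩ := exists_add_of_le h1.le
    have hw : 0 < w := by simpa using h1
    exact hmin' w hw ((by simpa using h2 : w < y).trans_le hy) ((hG x w hw).1 h3)
  constructor
  · intro H
    have hdm := div_add_mod γ g
    have hs : γ % g = 0 := by
      by_contra hs
      have hpos : 0 < γ % g := pos_iff_ne_zero.2 hs
      obtain ⟨z, h1, h2, h3⟩ := H (g * (γ / g)) (by
        conv_rhs => rw [← hdm]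
        simpa using hpos)
      rw [← hdm] at h2
      exact noG _ _ (mod_lt _ hg0.ne').le z h1 h2 h3
    rw [hs, add_zero] at hdm
    rcases zero_or_succ_or_isSuccLimit (γ / g) with h | ⟨q, hq⟩ | h
    · rw [h] at hdm; simp at hdm; exact absurd hdm.symm hγ.ne'
    · rw [← hq, Order.succ_eq_add_one, mul_add, mul_one] at hdm
      obtain ⟨z, h1, h2, h3⟩ := H (g * q) (by
        rw [← hdm]; simpa using hg0)
      rw [← hdm] at h2
      exact (noG _ _ le_rfl z h1 h2 h3).elim
    · rw [← hdm]
      exact mul_dvd_mul_left _ (isSuccLimit_iff_omega0_dvd.1 h).2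
  · rintro ⟨η, rfl⟩ y hy
    rw [mul_assoc] at hy hγ ⊢
    have hlim : Order.IsSuccLimit (ω * η) :=
      isSuccLimit_iff_omega0_dvd.2 ⟨fun h => by simp [h] at hγ, dvd_mul_right _ _⟩
    obtain ⟨ν, h1, h2⟩ := (lt_mul_iff_of_isSuccLimit hlim).1 hy
    refine ⟨g * ν + g, h2.trans_le le_self_add, ?_, (hG _ _ hg0).2 hgG⟩
    have : g * ν + g = g * (ν + 1) := by rw [mul_add, mul_one]
    rw [this, mul_lt_mul_iff_right₀ hg0]
    exact hlim.add_one_lt h1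

theorem aux_UP (D : Set Ordinal) (δ π a μ : Ordinal) (hπ : 0 < π) (haμ : a < μ)
    (h1 : ∀ γ < ω ^ μ, ∀ ξ < π, 0 < ξ → (δ + π * γ + ξ ∈ D ↔ δ + ξ ∈ D))
    (h2 : ∀ γ < ω ^ a, ∀ η, 0 < η → ω ^ a * η + γ < ω ^ μ →
      (δ + π * (ω ^ a * η + γ) ∈ D ↔ δ + π * (ω ^ a + γ) ∈ D)) :
    UP (D ∩ Set.Iio (δ + π * ω ^ μ)) (δ + π * ω ^ μ) := by
  obtain ⟨ν, rfl⟩ := exists_add_of_le haμ.le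
  have hν : 0 < ν := by simpa using haμ
  have hlim := aux_limit_opow hν
  have hpa : 0 < ω ^ a := opow_pos a omega0_pos
  have hone : 1 + ω ^ ν = ω ^ ν := add_of_omega0_opow_le (one_lt_of_isSuccLimit hlim) le_rfl
  have hP : 0 < π * ω ^ a := mul_pos hπ hpa
  have hβ : δ + π * ω ^ (a + ν) = (δ + π * ω ^ a) + (π * ω ^ a) * ω ^ ν := by
    conv_lhs => rw [opow_add, ← mul_assoc, ← hone, mul_add, mul_one, ← add_assoc]
  have e1 : ∀ γ ζ, δ + π * ω ^ a + π * ω ^ a * γ + ζ = δ + π * (ω ^ a * (1 + γ)) + ζ := by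
    intro γ ζ
    rw [mul_add, mul_one, mul_add, ← add_assoc, mul_assoc]
  have hlt : ∀ γ < ω ^ ν, ∀ ζ < π * ω ^ a,
      δ + π * ω ^ a + π * ω ^ a * γ + ζ < δ + π * ω ^ (a + ν) := by
    intro γ hγ ζ hζ
    rw [hβ, add_assoc _ (_ * γ), add_lt_add_iff_left]
    exact lt_mul_iff.2 ⟨γ, hγ, ζ, hζ, rfl⟩
  refine ⟨δ + π * ω ^ a, π * ω ^ a, ω ^ ν, ?_, hP, hlim, hβ, ?_⟩
  · rw [hβ]
    simpa using mul_pos hP (opow_pos ν omega0_pos)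
  intro γ hγ ζ hζ
  have hA := hlt γ hγ ζ hζ
  have hB := hlt 0 hlim.bot_lt ζ hζ
  have hE := e1 γ ζ
  have hF := e1 0 ζ
  rw [mul_zero, add_zero] at hB hF
  simp only [add_zero, mul_one] at hF
  simp only [Set.mem_inter_iff, Set.mem_Iio, hA, hB, and_true]
  rw [hE]
  obtain ⟨γ1, hγ1, ξ, hξ, rfl⟩ := lt_mul_iff.1 hζ
  have e2 : ∀ y, δ + π * y + (π * γ1 + ξ) = δ + π * (y + γ1) + ξ := by
    intro y
    rw [mul_add]; simp only [add_assoc]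
  rw [e2, e2]
  have hlt2 : ω ^ a * (1 + γ) + γ1 < ω ^ (a + ν) := by
    rw [opow_add]
    refine lt_mul_iff.2 ⟨1 + γ, ?_, γ1, hγ1, rfl⟩
    rw [← hone]; simpa using hγ
  have hlt3 : ω ^ a + γ1 < ω ^ (a + ν) := by
    rw [opow_add]
    exact lt_mul_iff.2 ⟨1, one_lt_of_isSuccLimit hlim, γ1, hγ1, by rw [mul_one]⟩
  rcases eq_or_ne ξ 0 with rfl | hξ0
  · rw [add_zero, add_zero]
    exact h2 γ1 hγ1 (1 + γ) (by simp [pos_iff_ne_zero]) hlt2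
  · rw [h1 _ hlt2 ξ hξ (pos_iff_ne_zero.2 hξ0), h1 _ hlt3 ξ hξ (pos_iff_ne_zero.2 hξ0)]

theorem aux_UP_dvd (D : Set Ordinal) (δ π a μ : Ordinal) (hπ : 0 < π) (hμ : 0 < μ)
    (h1 : ∀ γ < ω ^ μ, ∀ ξ < π, 0 < ξ → (δ + π * γ + ξ ∈ D ↔ δ + ξ ∈ D))
    (h2 : ∀ γ < ω ^ μ, 0 < γ → (δ + π * γ ∈ D ↔ ω ^ a ∣ γ)) :
    UP (D ∩ Set.Iio (δ + π * ω ^ μ)) (δ + π * ω ^ μ) := by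
  have hpa : 0 < ω ^ a := opow_pos a omega0_pos
  rcases lt_or_ge a μ with haμ | haμ
  · apply aux_UP D δ π a μ hπ haμ h1
    intro γ hγ η hη hlt
    have hle : ω ^ a ≤ ω ^ a * η := le_mul_of_one_le_right' (Order.one_le_iff_pos.2 hη)
    have hlt' : ω ^ a + γ < ω ^ μ := lt_of_le_of_lt (by gcongr) hlt
    rw [h2 _ hlt ((hpa.trans_le hle).trans_le le_self_add),
      h2 _ hlt' (hpa.trans_le le_self_add), dvd_add_iff (dvd_mul_right _ _),
      dvd_add_iff dvd_rfl]
  · apply aux_UP D δ π 0 μ hπ hμ h1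
    have hno : ∀ γ < ω ^ μ, 0 < γ → ¬ (δ + π * γ ∈ D) := by
      intro γ hγ h0 h
      rw [h2 γ hγ h0] at h
      have := le_of_dvd h0.ne' h
      exact absurd (hγ.trans_le (opow_le_opow_right omega0_pos haμ)) (not_lt.2 this)
    intro γ hγ η hη hlt
    have hγ0 : γ = 0 := by simpa using hγ
    subst hγ0
    simp only [opow_zero, one_mul, add_zero] at hlt ⊢
    exact iff_of_false (hno _ hlt hη)
      (hno _ (one_lt_of_isSuccLimit (aux_limit_opow hμ)) one_pos)

theorem aux_main (S : Set Ordinal) (G : Ordinal → Prop) (hG : ∀ x y, 0 < y → (G (x + y) ↔ G y))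
    (δ π μ : Ordinal) (hπ : 0 < π) (hμ : 0 < μ)
    (h1 : ∀ γ < ω ^ μ, ∀ ξ < π, 0 < ξ → (δ + π * γ + ξ ∈ S ↔ δ + ξ ∈ S))
    (h2 : ∀ γ < ω ^ μ, 0 < γ → (δ + π * γ ∈ S ↔ G γ)) :
    UP (d0 S ∩ Set.Iio (δ + π * ω ^ μ)) (δ + π * ω ^ μ) := by
  have hD : ∀ γ < ω ^ μ, ∀ ξ ≤ π, 0 < ξ → (δ + π * γ + ξ ∈ d0 S ↔ δ + ξ ∈ d0 S) := by
    intro γ hγ ξ hξ h0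
    rw [aux_d0_add S _ h0, aux_d0_add S _ h0]
    refine forall₂_congr fun y hy => exists_congr fun z => ?_
    refine and_congr_right fun hz => and_congr_right fun hz' => ?_
    exact h1 γ hγ z (hz'.trans_le hξ) (zero_le.trans_lt hz)
  have hD1 := fun γ hγ ξ (hξ : ξ < π) => hD γ hγ ξ hξ.le
  have hsucc : ∀ γ, δ + π * (γ + 1) = δ + π * γ + π := by
    intro γ; rw [mul_add, mul_one, add_assoc]
  by_cases hne : ∃ ξ, 0 < ξ ∧ ξ < π ∧ δ + ξ ∈ S
  · obtain ⟨ξ, hξ0, hξ, hξS⟩ := hne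
    have hlimD : ∀ γ < ω ^ μ, Order.IsSuccLimit γ → δ + π * γ ∈ d0 S := by
      intro γ hγ hl
      rw [aux_d0_add S _ (mul_pos hπ hl.bot_lt)]
      intro y hy
      obtain ⟨ν, hν, hyν⟩ := (lt_mul_iff_of_isSuccLimit hl).1 hy
      refine ⟨π * ν + ξ, hyν.trans_le le_self_add, lt_mul_iff.2 ⟨ν, hν, ξ, hξ, rfl⟩, ?_⟩
      rw [← add_assoc]
      exact (h1 ν (hν.trans hγ) ξ hξ hξ0).2 hξS
    by_cases hc : δ + π ∈ d0 S
    · apply aux_UP_dvd _ δ π 0 μ hπ hμ hD1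
      intro γ hγ h0
      refine iff_of_true ?_ (by simp)
      rcases zero_or_succ_or_isSuccLimit γ with h | ⟨q, rfl⟩ | h
      · exact absurd h h0.ne'
      · rw [Order.succ_eq_add_one] at *
        rw [hsucc]
        exact (hD q (lt_of_le_of_lt le_self_add hγ) π le_rfl hπ).2 hc
      · exact hlimD γ hγ h
    · apply aux_UP_dvd _ δ π 1 μ hπ hμ hD1
      intro γ hγ h0
      rw [opow_one]
      rcases zero_or_succ_or_isSuccLimit γ with h | ⟨q, rfl⟩ | h
      · exact absurd h h0.ne'
      · rw [Order.succ_eq_add_one] at *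
        rw [hsucc]
        refine iff_of_false ?_ (aux_add_omega q)
        rw [hD q (lt_of_le_of_lt le_self_add hγ) π le_rfl hπ]
        exact hc
      · exact iff_of_true (hlimD γ hγ h) (isSuccLimit_iff_omega0_dvd.1 h).2
  · have key : ∀ γ < ω ^ μ, 0 < γ →
        (δ + π * γ ∈ d0 S ↔ ∀ y < γ, ∃ z, y < z ∧ z < γ ∧ G z) := by
      intro γ hγ h0
      rw [aux_d0_add S _ (mul_pos hπ h0)]
      constructor
      · intro H y hy
        obtain ⟨w, hw1, hw2, hw3⟩ := H (π * y) (by rwa [mul_lt_mul_iff_right₀ hπ])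
        obtain ⟨z, hz, ξ, hξ, rfl⟩ := lt_mul_iff.1 hw2
        have hξ0 : ξ = 0 := by
          by_contra hc
          have hc' := pos_iff_ne_zero.2 hc
          rw [← add_assoc] at hw3
          exact hne ⟨ξ, hc', hξ, (h1 z (hz.trans hγ) ξ hξ hc').1 hw3⟩
        subst hξ0
        rw [add_zero] at *
        have hyz := (mul_lt_mul_iff_right₀ hπ).1 hw1
        exact ⟨z, hyz, hz, (h2 z (hz.trans hγ) (zero_le.trans_lt hyz)).1 hw3⟩
      · intro H y hy
        obtain ⟨q, hq, r, hr, rfl⟩ := lt_mul_iff.1 hy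
        obtain ⟨z, hz1, hz2, hz3⟩ := H q hq
        refine ⟨π * z, lt_mul_iff.2 ⟨q, hz1, r, hr, rfl⟩, by rwa [mul_lt_mul_iff_right₀ hπ], ?_⟩
        exact (h2 z (hz2.trans hγ) (zero_le.trans_lt hz1)).2 hz3
    rcases aux_G G hG with hno | ⟨a, ha⟩
    · apply aux_UP_dvd _ δ π μ μ hπ hμ hD1
      intro γ hγ h0
      refine iff_of_false ?_ fun h => absurd hγ (not_lt.2 (le_of_dvd h0.ne' h))
      rw [key γ hγ h0]
      intro H
      obtain ⟨z, hz1, hz2, hz3⟩ := H 0 h0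
      exact hno z hz1 hz3
    · apply aux_UP_dvd _ δ π a μ hπ hμ hD1
      intro γ hγ h0
      rw [key γ hγ h0, ha γ h0]

/-- If `B ∈ H₀(Ω)` and `A` is any set of ordinals, then
`d₀(B ∩ {α < Ω : ℓ(α) ∈ A}) ∩ Ω ∈ H₀(Ω)`. -/
theorem H0_d0_ell_preimage (Ω : Ordinal) (B A : Set Ordinal) (hB : B ∈ H0 Ω) :
    d0 (B ∩ {α : Ordinal | α < Ω ∧ ell α ∈ A}) ∩ Set.Iio Ω ∈ H0 Ω := by
  refine ⟨Set.inter_subset_right, fun β hβ hl => ?_⟩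
  obtain ⟨δ, π, lam, hδ, hπ, hlam, hΩ, hper⟩ := hB.2 β hβ hl
  obtain ⟨s, hs⟩ := aux_ell_spec lam hlam.bot_lt.ne'
  set μ := ell lam
  have hμ : 0 < μ := by
    rw [pos_iff_ne_zero]
    intro h0
    rw [h0, opow_zero, one_mul] at hs
    exact aux_add_omega s (hs ▸ (isSuccLimit_iff_omega0_dvd.1 hlam).2)
  have hpμ : (0 : Ordinal) < ω ^ μ := opow_pos μ omega0_pos
  set κ := ω ^ μ * s with hκ
  have hs' : lam = κ + ω ^ μ := by rw [hs, mul_add, mul_one]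
  have hβ' : β = (δ + π * κ) + π * ω ^ μ := by
    rw [hΩ, hs', mul_add, add_assoc]
  have hltlam : ∀ γ < ω ^ μ, κ + γ < lam := by
    intro γ hγ; rw [hs']; simpa using hγ
  have hlt : ∀ γ < ω ^ μ, ∀ ξ < π, δ + π * κ + π * γ + ξ < β := by
    intro γ hγ ξ hξ
    rw [hβ', add_assoc _ (_ * γ), add_lt_add_iff_left]
    exact lt_mul_iff.2 ⟨γ, hγ, ξ, hξ, rfl⟩
  have hperB : ∀ γ < ω ^ μ, ∀ ξ < π,
      (δ + π * κ + π * γ + ξ ∈ B ↔ δ + π * κ + ξ ∈ B) := by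
    intro γ hγ ξ hξ
    have a1 := hper (κ + γ) (hltlam γ hγ) ξ hξ
    have a2 := hper κ (by simpa using hltlam 0 hpμ) ξ hξ
    rw [mul_add, ← add_assoc] at a1
    have b1 := hlt γ hγ ξ hξ
    have b2 := hlt 0 hpμ ξ hξ
    rw [mul_zero, add_zero] at b2
    have := a1.trans a2.symm
    simpa only [Set.mem_inter_iff, Set.mem_Iio, b1, b2, and_true] using this
  have hset : d0 (B ∩ {α : Ordinal | α < Ω ∧ ell α ∈ A}) ∩ Set.Iio Ω ∩ Set.Iio β
      = d0 (B ∩ {α : Ordinal | α < Ω ∧ ell α ∈ A}) ∩ Set.Iio β := by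
    rw [Set.inter_assoc, Set.Iio_inter_Iio, min_eq_right hβ]
  rw [hset, hβ']
  apply aux_main _ (fun γ => δ + π * κ ∈ B ∧ ell (π * γ) ∈ A) _ _ _ _ hπ hμ
  · intro γ hγ ξ hξ h0
    have b1 := (hlt γ hγ ξ hξ).trans_le hβ
    have b2 := (hlt 0 hpμ ξ hξ).trans_le hβ
    rw [mul_zero, add_zero] at b2
    simp only [Set.mem_inter_iff, Set.mem_ofPred_eq, b1, b2, true_and, hperB γ hγ ξ hξ,
      aux_ell_add _ h0]
  · intro γ hγ h0
    have b1 := (hlt γ hγ 0 hπ).trans_le hβ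
    have b3 := hperB γ hγ 0 hπ
    rw [add_zero] at b1 b3
    rw [add_zero] at b3
    simp only [Set.mem_inter_iff, Set.mem_ofPred_eq, b1, true_and, b3,
      aux_ell_add _ (mul_pos hπ h0)]
  · intro x y hy
    simp only [mul_add, aux_ell_add _ (mul_pos hπ hy)]
end
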